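/- arXiv:1810.10070 — 2 statements merged into one kernel-verified Lean document; each statement's English description precedes it below -/
import Mathlib

section
/- Let f ∈ H²(𝔹). Suppose that for all ω ∈ 𝔹 one has (1/2π) ∫₀^{2π} log |f_{I_ω} ∘ τ_ω(e^{θ I_ω})| dθ = log |f(ω)|, where τ_ω is the slice regular Möbius transformation of 𝔹 taking 0 to ω and I_ω is the imaginary unit identified by ω. Then f is outer. -/
open MeasureTheory Filter Topology
open scoped ENNReal Classical

noncomputable section

/-! ### Basic quaternionic notions -/

instance : MeasurableSpace (Quaternion ℝ) := borel _
instance : BorelSpace (Quaternion ℝ) := ⟨rfl⟩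

/-- The 2-sphere `𝕊` of quaternionic imaginary units. -/
def USphere : Set (Quaternion ℝ) := {q | q ^ 2 = -1}

/-- The open quaternionic unit ball `𝔹`. -/
def QBall : Set (Quaternion ℝ) := {q | ‖q‖ < 1}

/-- The slice `L_I = ℝ + ℝI` through an imaginary unit `I`. -/
def sliceSet (I : Quaternion ℝ) : Set (Quaternion ℝ) :=
  {q | ∃ x y : ℝ, q = (x : Quaternion ℝ) + y • I}

/-- The point `e^{tI} = cos t + (sin t) I` of the boundary circle `∂𝔹_I`. -/
def ptOn (I : Quaternion ℝ) (t : ℝ) : Quaternion ℝ :=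
  ((Real.cos t : ℝ) : Quaternion ℝ) + Real.sin t • I

/-- Slice regularity on the unit ball: on every slice the restriction of `f` has partial
derivatives satisfying the Cauchy–Riemann equation `∂f/∂x + I ∂f/∂y = 0`. -/
def SliceRegular (f : Quaternion ℝ → Quaternion ℝ) : Prop :=
  ∀ I ∈ USphere, ∀ x y : ℝ, ((x : Quaternion ℝ) + y • I) ∈ QBall →
    ∃ fx fy : Quaternion ℝ,
      HasDerivAt (fun s : ℝ => f ((s : Quaternion ℝ) + y • I)) fx x ∧
      HasDerivAt (fun t : ℝ => f ((x : Quaternion ℝ) + t • I)) fy y ∧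
      fx + I * fy = 0

/-! ### The Hardy space `H²(𝔹)` via power series coefficients.
A slice regular function on `𝔹` is identified with its coefficient sequence
`a : ℕ → ℍ`, the function being `q ↦ ∑ qⁿ aₙ`. -/

/-- Membership in `H²(𝔹)`: square-summable coefficients. -/
def MemH2 (a : ℕ → Quaternion ℝ) : Prop := Summable (fun n => ‖a n‖ ^ 2)

/-- Evaluation of the power series `q ↦ ∑ qⁿ aₙ`. -/
def evalS (a : ℕ → Quaternion ℝ) (q : Quaternion ℝ) : Quaternion ℝ := ∑' n, q ^ n * a n

/-- The `*`-product (slice product) on coefficient sequences. -/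
def sProd (a b : ℕ → Quaternion ℝ) : ℕ → Quaternion ℝ :=
  fun n => ∑ k ∈ Finset.range (n + 1), a k * b (n - k)

/-- The regular conjugate `fᶜ`. -/
def conjS (a : ℕ → Quaternion ℝ) : ℕ → Quaternion ℝ := fun n => star (a n)

/-- The symmetrization `fˢ = f * fᶜ`. -/
def symmS (a : ℕ → Quaternion ℝ) : ℕ → Quaternion ℝ := sProd a (conjS a)

/-- The squared `H²` norm `∑ ‖aₙ‖²`. -/
def h2normSq (a : ℕ → Quaternion ℝ) : ℝ := ∑' n, ‖a n‖ ^ 2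

/-- The `H²` norm. -/
def h2norm (a : ℕ → Quaternion ℝ) : ℝ := Real.sqrt (h2normSq a)

/-- The (right) quaternionic inner product `⟨f,g⟩ = ∑ conj(bₙ) aₙ` of `H²(𝔹)`. -/
def h2inner (a b : ℕ → Quaternion ℝ) : Quaternion ℝ := ∑' n, star (b n) * a n

/-- Squared `H²`-distance of two coefficient sequences (valued in `ℝ≥0∞`). -/
def h2distSq (a b : ℕ → Quaternion ℝ) : ℝ≥0∞ := ∑' n, (‖a n - b n‖₊ : ℝ≥0∞) ^ 2

/-- The boundary value function of `f ∈ H²(𝔹)`, given by the radial limit where it exists. -/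
def bdval (a : ℕ → Quaternion ℝ) (q : Quaternion ℝ) : Quaternion ℝ :=
  if h : ∃ L, Tendsto (fun r : ℝ => evalS a ((r : Quaternion ℝ) * q)) (𝓝[<] (1 : ℝ)) (𝓝 L)
  then h.choose else 0

/-! ### The measure `Σ` on `∂𝔹` with `dΣ(e^{tI}) = dσ(I) dt`. -/

/-- The normalized area measure `σ` on the sphere `𝕊` of imaginary units
(2-dimensional Hausdorff measure, normalized so that `σ(𝕊) = 1`). -/
def sphMeasure : Measure (Quaternion ℝ) := (μH[2] USphere)⁻¹ • (μH[2]).restrict USphere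

/-- The measure `Σ` on `∂𝔹`, `dΣ(e^{tI}) = dσ(I) dt`, normalized so `Σ(∂𝔹) = 1`. -/
def SigmaBd : Measure (Quaternion ℝ) :=
  (ENNReal.ofReal (2 * Real.pi))⁻¹ •
    Measure.map (fun p : ℝ × Quaternion ℝ => ptOn p.2 p.1)
      ((volume.restrict (Set.Ico 0 (2 * Real.pi))).prod sphMeasure)

/-! ### Inner, outer, cyclic -/

/-- `f ∈ H^∞(𝔹)`: a bounded function of `H²(𝔹)`. -/
def MemHinf (a : ℕ → Quaternion ℝ) : Prop :=
  MemH2 a ∧ ∃ C : ℝ, ∀ q ∈ QBall, ‖evalS a q‖ ≤ C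

/-- The `H^∞` norm: the sup of `‖f‖` on the ball. -/
def hInfNorm (a : ℕ → Quaternion ℝ) : ℝ := sSup ((fun q => ‖evalS a q‖) '' QBall)

/-- `f` is inner: `f ∈ H^∞(𝔹)`, `‖f‖ ≤ 1` on `𝔹` and `‖f‖ = 1` `Σ`-a.e. on `∂𝔹`. -/
def IsInnerQ (a : ℕ → Quaternion ℝ) : Prop :=
  MemH2 a ∧ (∀ q ∈ QBall, ‖evalS a q‖ ≤ 1) ∧ (∀ᵐ q ∂SigmaBd, ‖bdval a q‖ = 1)

/-- `g` is outer: whenever `f ∈ H²(𝔹)` has the same boundary modulus `Σ`-a.e.,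
then `‖g‖ ≥ ‖f‖` throughout `𝔹`. -/
def IsOuterQ (g : ℕ → Quaternion ℝ) : Prop :=
  MemH2 g ∧ ∀ f, MemH2 f → (∀ᵐ q ∂SigmaBd, ‖bdval g q‖ = ‖bdval f q‖) →
    ∀ q ∈ QBall, ‖evalS f q‖ ≤ ‖evalS g q‖

/-- Quaternionic polynomials (finitely supported coefficient sequences). -/
def IsPolyQ (p : ℕ → Quaternion ℝ) : Prop := ∃ N, ∀ n > N, p n = 0

/-- Quaternionic polynomials of degree at most `n` (the space `𝒫_n`). -/
def IsPolyDeg (p : ℕ → Quaternion ℝ) (n : ℕ) : Prop := ∀ m > n, p m = 0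

/-- The coefficient sequence of the monomial `qᵏ`. -/
def qpow (k : ℕ) : ℕ → Quaternion ℝ := fun n => if n = k then 1 else 0

/-- The coefficient sequence of a constant function. -/
def constS (c : Quaternion ℝ) : ℕ → Quaternion ℝ := fun n => if n = 0 then c else 0

/-- The coefficient sequence of the constant function `1`. -/
def oneS : ℕ → Quaternion ℝ := constS 1

/-- The invariant subspace `[g]`: the `H²`-closure of `{g * p : p polynomial}`,
i.e. of the right span of `{qⁿ * g : n ≥ 0}`. -/
def InvSub (g : ℕ → Quaternion ℝ) : Set (ℕ → Quaternion ℝ) :=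
  {h | MemH2 h ∧ ∀ ε : ℝ≥0∞, 0 < ε → ∃ p, IsPolyQ p ∧ h2distSq (sProd g p) h < ε}

/-- `g` is cyclic: `[g] = H²(𝔹)`. -/
def IsCyclicQ (g : ℕ → Quaternion ℝ) : Prop :=
  MemH2 g ∧ ∀ h, MemH2 h → h ∈ InvSub g

/-! ### Bilateral (slice `L²`) series, used for boundary products -/

/-- Bilateral coefficients of `f̃(q) = f(q̄)` on `∂𝔹`: `Σ_{n ≤ 0} qⁿ a_{-n}`. -/
def tildeZ (a : ℕ → Quaternion ℝ) : ℤ → Quaternion ℝ :=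
  fun k => if k ≤ 0 then a (-k).toNat else 0

/-- Bilateral coefficients of `fᶜ` on `∂𝔹`. -/
def conjZ (a : ℕ → Quaternion ℝ) : ℤ → Quaternion ℝ :=
  fun k => if 0 ≤ k then star (a k.toNat) else 0

/-- The `*`-product of two slice `L²` functions on the boundary, on coefficients. -/
def convZ (c b : ℤ → Quaternion ℝ) : ℤ → Quaternion ℝ := fun n => ∑' k : ℤ, c k * b (n - k)

/-- Evaluation of a bilateral series `q ↦ ∑_{n ∈ ℤ} qⁿ dₙ`. -/
def evalZ (d : ℤ → Quaternion ℝ) (q : Quaternion ℝ) : Quaternion ℝ := ∑' n : ℤ, q ^ n * d n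

/-- The slice inner product `⟨qᵏ * f, f⟩_I = (1/2π)∫₀^{2π} conj(f(e^{θI})) (e^{θI})ᵏ f(e^{θI}) dθ`,
computed with boundary values; note `(qᵏ * f)(q) = qᵏ f(q)` pointwise. -/
def sliceInnerPow (a : ℕ → Quaternion ℝ) (I : Quaternion ℝ) (k : ℕ) : Quaternion ℝ :=
  (2 * Real.pi)⁻¹ •
    ∫ t in Set.Ico 0 (2 * Real.pi), star (bdval a (ptOn I t)) * ((ptOn I t) ^ k * bdval a (ptOn I t))

/-! ### Complex Hardy space `H²(𝔻)` notions (for slice restrictions) -/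

/-- Membership in the complex Hardy space `H²(𝔻)` via coefficients. -/
def CMemH2 (c : ℕ → ℂ) : Prop := Summable (fun n => ‖c n‖ ^ 2)

/-- Evaluation of a complex power series. -/
def cEval (c : ℕ → ℂ) (z : ℂ) : ℂ := ∑' n, z ^ n * c n

/-- Cauchy product of complex coefficient sequences. -/
def cConv (c d : ℕ → ℂ) : ℕ → ℂ := fun n => ∑ k ∈ Finset.range (n + 1), c k * d (n - k)

/-- Squared `H²(𝔻)` distance. -/
def cDistSq (c d : ℕ → ℂ) : ℝ≥0∞ := ∑' n, (‖c n - d n‖₊ : ℝ≥0∞) ^ 2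

/-- Radial boundary values of a complex `H²` function. -/
def cBdval (c : ℕ → ℂ) (z : ℂ) : ℂ :=
  if h : ∃ L, Tendsto (fun r : ℝ => cEval c ((r : ℂ) * z)) (𝓝[<] (1 : ℝ)) (𝓝 L)
  then h.choose else 0

/-- Lebesgue measure on the unit circle `∂𝔻` (parametrized by `θ ∈ [0, 2π)`). -/
def circleM : Measure ℂ :=
  Measure.map (fun t : ℝ => Complex.exp (t * Complex.I)) (volume.restrict (Set.Ico 0 (2 * Real.pi)))

/-- Cyclicity in `H²(𝔻)`: polynomial multiples of `c` are dense. -/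
def CIsCyclic (c : ℕ → ℂ) : Prop :=
  CMemH2 c ∧ ∀ h, CMemH2 h → ∀ ε : ℝ≥0∞, 0 < ε →
    ∃ p : ℕ → ℂ, (∃ N, ∀ n > N, p n = 0) ∧ cDistSq (cConv c p) h < ε

/-- Outerness in `H²(𝔻)` (in the sense matching Definition 2.10 of the paper). -/
def CIsOuter (c : ℕ → ℂ) : Prop :=
  CMemH2 c ∧ ∀ h, CMemH2 h →
    (∀ᵐ z ∂circleM, ‖cBdval c z‖ = ‖cBdval h z‖) →
    ∀ z ∈ Metric.ball (0 : ℂ) 1, ‖cEval h z‖ ≤ ‖cEval c z‖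

/-- Complex coordinates of a point of the slice `L_I`: if `p = x + yI` then
`sliceToC I p = x + iy`. -/
def sliceToC (I : Quaternion ℝ) (p : Quaternion ℝ) : ℂ := ⟨p.re, -(p * I).re⟩

/-- The quaternion `i`. -/
def qI : Quaternion ℝ := ⟨0, 1, 0, 0⟩

/-- The embedding of `ℂ = L_i` into the quaternions. -/
def cToQ (z : ℂ) : Quaternion ℝ := (z.re : Quaternion ℝ) + z.im • qI

/-- The imaginary unit `I_ω` identified by `ω` (any imaginary unit if `ω` is real). -/
def Iu (ω : Quaternion ℝ) : Quaternion ℝ := if ω.im = 0 then qI else ‖ω.im‖⁻¹ • ω.im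

/-! ### Optimal approximants -/

/-- `p` is an optimal approximant of degree `n` of `f^{-*}`: `p ∈ 𝒫_n` minimizes
`‖f * p - 1‖_{H²}` among all `p ∈ 𝒫_n`. -/
def IsOptApprox (a : ℕ → Quaternion ℝ) (n : ℕ) (p : ℕ → Quaternion ℝ) : Prop :=
  IsPolyDeg p n ∧ ∀ r, IsPolyDeg r n → h2distSq (sProd a p) oneS ≤ h2distSq (sProd a r) oneS

end

theorem cH_summable {c : ℕ → ℂ} (hc : CMemH2 c) {z : ℂ} (hz : ‖z‖ < 1) :
    Summable (fun n => ‖z‖ ^ n * ‖c n‖) := by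
  have h1 : Summable (fun n : ℕ => (‖z‖ ^ n) ^ 2) := by
    have : (fun n : ℕ => (‖z‖ ^ n) ^ 2) = fun n => (‖z‖ ^ 2) ^ n := by
      ext n; rw [← pow_mul, ← pow_mul, mul_comm]
    rw [this]
    exact summable_geometric_of_lt_one (by positivity) (by nlinarith [norm_nonneg z])
  refine Summable.of_nonneg_of_le (fun n => by positivity) (fun n => ?_) (h1.add hc)
  nlinarith [sq_nonneg (‖z‖ ^ n - ‖c n‖), sq_nonneg (‖z‖ ^ n + ‖c n‖)]

theorem cH_hasFPower {c : ℕ → ℂ} (hc : CMemH2 c) :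
    HasFPowerSeriesOnBall (cEval c) (FormalMultilinearSeries.ofScalars ℂ c) 0 1 := by
  have hr : (1 : ℝ≥0∞) ≤ (FormalMultilinearSeries.ofScalars ℂ c).radius := by
    refine ENNReal.le_of_forall_nnreal_lt fun r hr => ?_
    refine FormalMultilinearSeries.le_radius_of_summable_norm _ ?_
    have hr1 : (r : ℝ) < 1 := by exact_mod_cast hr
    have := cH_summable hc (z := (r : ℂ)) (by simpa using hr1)
    refine this.congr fun n => ?_
    simp [mul_comm]
  have h2 := (FormalMultilinearSeries.ofScalars ℂ c).hasFPowerSeriesOnBall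
    (lt_of_lt_of_le one_pos hr)
  have h3 := h2.mono one_pos hr
  have : cEval c = (FormalMultilinearSeries.ofScalars ℂ c).sum := by
    ext z
    simp [cEval, FormalMultilinearSeries.sum, mul_comm]
  rw [this]; exact h3

theorem cH_analytic {c : ℕ → ℂ} (hc : CMemH2 c) :
    AnalyticOnNhd ℂ (cEval c) (Metric.ball 0 1) := by
  have h := (cH_hasFPower hc).analyticOnNhd
  convert h using 1
  ext z
  simp [← ofReal_norm, ENNReal.ofReal_lt_one]

theorem cH_zero {c : ℕ → ℂ} (hc : CMemH2 c) (h : ∀ z ∈ Metric.ball (0:ℂ) 1, cEval c z = 0) :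
    ∀ n, c n = 0 := by
  have h1 := (cH_hasFPower hc).hasFPowerSeriesAt
  have h2 : cEval c =ᶠ[𝓝 0] fun _ => 0 := by
    filter_upwards [Metric.ball_mem_nhds (0:ℂ) one_pos] with z hz using h z hz
  have h3 := (h1.congr h2).eq_zero
  intro n
  have := FormalMultilinearSeries.ofScalars_series_eq_zero (E := ℂ) (𝕜 := ℂ) (c := c)
  have h4 := this.1 h3
  exact congrFun h4 n

theorem int_exp_int (k : ℤ) :
    ∫ t in (0:ℝ)..2 * Real.pi, Complex.exp ((k * Complex.I) * t)
      = if k = 0 then (2 * Real.pi : ℂ) else 0 := by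
  split_ifs with h
  · simp [h]
  · rw [integral_exp_mul_complex (by simp [h])]
    have : Complex.exp ((k * Complex.I) * (2 * Real.pi : ℝ)) = 1 := by
      rw [← Complex.exp_int_mul_two_pi_mul_I k]; congr 1; push_cast; ring
    rw [this]; simp

theorem trig_poly_sq (N : ℕ) (d : ℕ → ℂ) :
    ∫ t in (0:ℝ)..2 * Real.pi, ‖∑ n ∈ Finset.range N, d n * Complex.exp (t * Complex.I) ^ n‖ ^ 2
      = 2 * Real.pi * ∑ n ∈ Finset.range N, ‖d n‖ ^ 2 := by
  have key : ((∫ t in (0:ℝ)..2 * Real.pi,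
      ‖∑ n ∈ Finset.range N, d n * Complex.exp (t * Complex.I) ^ n‖ ^ 2 : ℝ) : ℂ)
      = ((2 * Real.pi * ∑ n ∈ Finset.range N, ‖d n‖ ^ 2 : ℝ) : ℂ) := by
    rw [← intervalIntegral.integral_ofReal]
    have : ∀ t : ℝ, ((‖∑ n ∈ Finset.range N, d n * Complex.exp (t * Complex.I) ^ n‖ ^ 2 : ℝ) : ℂ)
        = ∑ n ∈ Finset.range N, ∑ m ∈ Finset.range N, (d n * (starRingEnd ℂ) (d m)) *
          Complex.exp ((((n:ℤ) - (m:ℤ) : ℤ) * Complex.I) * t) := by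
      intro t
      rw [Complex.ofReal_pow, ← Complex.mul_conj', map_sum, Finset.sum_mul_sum]
      refine Finset.sum_congr rfl fun n _ => Finset.sum_congr rfl fun m _ => ?_
      rw [map_mul, map_pow, ← Complex.exp_conj]
      rw [show (((n:ℤ) - (m:ℤ) : ℤ) * Complex.I) * (t:ℂ) = n * (t * Complex.I) + m * (-(t*Complex.I)) by
        push_cast; ring, Complex.exp_add, Complex.exp_nat_mul, Complex.exp_nat_mul]
      simp; ring
    simp_rw [this]
    rw [intervalIntegral.integral_finsetSum]
    · have : ∀ n ∈ Finset.range N, ∫ (x : ℝ) in 0..2 * Real.pi, ∑ m ∈ Finset.range N, (d n * (starRingEnd ℂ) (d m)) *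
          Complex.exp ((((n:ℤ) - (m:ℤ) : ℤ) * Complex.I) * x) = 2 * Real.pi * (‖d n‖:ℂ)^2 := by
        intro n hn
        rw [intervalIntegral.integral_finsetSum]
        · simp_rw [intervalIntegral.integral_const_mul, int_exp_int]
          rw [Finset.sum_eq_single n]
          · simp [Complex.mul_conj']; ring
          · intro m _ hm
            rw [if_neg]; simp; omega
          · intro h; exact absurd hn h
        · intro m _
          exact Continuous.intervalIntegrable (by fun_prop) _ _
      rw [Finset.sum_congr rfl this, ← Finset.mul_sum]; push_cast; rfl
    · intro n _
      exact Continuous.intervalIntegrable (by fun_prop) _ _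
  exact_mod_cast key

theorem norm_circ (r t : ℝ) (h0 : 0 ≤ r) : ‖(r:ℂ) * Complex.exp (t * Complex.I)‖ = r := by
  rw [norm_mul, Complex.norm_exp_ofReal_mul_I]; simp [abs_of_nonneg h0]

theorem cH_cont_circ {c : ℕ → ℂ} (hc : CMemH2 c) {r : ℝ} (h0 : 0 ≤ r) (h1 : r < 1) :
    Continuous (fun t : ℝ => cEval c (r * Complex.exp (t * Complex.I))) := by
  refine (cH_analytic hc).continuousOn.comp_continuous (by fun_prop) fun t => ?_
  rw [mem_ball_zero_iff, norm_circ _ _ h0]; exact h1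

theorem cH_L2_bound {c : ℕ → ℂ} (hc : CMemH2 c) {r : ℝ} (h0 : 0 ≤ r) (h1 : r < 1) :
    ∫ t in (0:ℝ)..2 * Real.pi, ‖cEval c (r * Complex.exp (t * Complex.I))‖ ^ 2
      ≤ 2 * Real.pi * ∑' n, ‖c n‖ ^ 2 := by
  have hs : Summable (fun n => r ^ n * ‖c n‖) := by
    simpa [abs_of_nonneg h0] using cH_summable hc (z := (r:ℂ)) (by simpa [abs_of_nonneg h0] using h1)
  have hlim : Tendsto (fun N : ℕ => ∫ t in (0:ℝ)..2 * Real.pi,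
      ‖∑ n ∈ Finset.range N, ((r:ℂ)^n * c n) * Complex.exp (t * Complex.I) ^ n‖ ^ 2) atTop
      (𝓝 (∫ t in (0:ℝ)..2 * Real.pi, ‖cEval c (r * Complex.exp (t * Complex.I))‖ ^ 2)) := by
    refine intervalIntegral.tendsto_integral_filter_of_dominated_convergence
      (fun _ => (∑' n, r ^ n * ‖c n‖) ^ 2) ?_ ?_ ?_ ?_
    · exact Eventually.of_forall fun N => (by fun_prop : Continuous _).aestronglyMeasurable
    · refine Eventually.of_forall fun N => Eventually.of_forall fun t _ => ?_
      rw [Real.norm_of_nonneg (by positivity)]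
      gcongr
      refine (norm_sum_le _ _).trans ?_
      refine le_trans (le_of_eq (Finset.sum_congr rfl fun n _ => ?_))
        (hs.sum_le_tsum (Finset.range N) (fun n _ => by positivity))
      rw [norm_mul, norm_mul, norm_pow, norm_pow, Complex.norm_exp_ofReal_mul_I]
      simp [abs_of_nonneg h0]
    · exact intervalIntegrable_const
    · refine Eventually.of_forall fun t _ => ?_
      have : HasSum (fun n => ((r:ℂ)^n * c n) * Complex.exp (t * Complex.I) ^ n)
          (cEval c (r * Complex.exp (t * Complex.I))) := by
        have hs2 : Summable (fun n => ((r:ℂ) * Complex.exp (t * Complex.I)) ^ n * c n) := by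
          refine Summable.of_norm (hs.congr fun n => ?_)
          rw [norm_mul, norm_pow, norm_circ _ _ h0]
        refine hs2.hasSum.congr_fun ?_ |> fun h => h
        intro n; ring
      exact ((this.tendsto_sum_nat).norm.pow 2)
  refine le_of_tendsto hlim (Eventually.of_forall fun N => ?_)
  rw [trig_poly_sq]
  gcongr
  refine le_trans (Finset.sum_le_sum fun n _ => ?_) (hc.sum_le_tsum (Finset.range N) (fun n _ => by positivity))
  rw [norm_mul, norm_pow]
  have : ‖(r:ℂ)‖ ^ n ≤ 1 := pow_le_one₀ (norm_nonneg _) (by simpa [abs_of_nonneg h0] using h1.le)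
  have h3 := norm_nonneg (c n)
  have : ‖(r:ℂ)‖ ^ n * ‖c n‖ ≤ ‖c n‖ := by nlinarith
  gcongr

/-- variation of a C¹ function -/
theorem eVar_le_of_deriv {f f' : ℝ → ℂ} (hf : ∀ t, HasDerivAt f (f' t) t) (hc : Continuous f')
    {a b C : ℝ} (hC : ∫ t in a..b, ‖f' t‖ ≤ C) :
    eVariationOn f (Set.Icc a b) ≤ ENNReal.ofReal C := by
  refine iSup_le ?_
  rintro ⟨n, u, hu, hus⟩
  simp only
  have hstep : ∀ i ∈ Finset.range n, edist (f (u (i+1))) (f (u i)) ≤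
      ENNReal.ofReal (∫ t in (u i)..(u (i+1)), ‖f' t‖) := by
    intro i _
    rw [edist_dist, dist_eq_norm]
    refine ENNReal.ofReal_le_ofReal ?_
    rw [← intervalIntegral.integral_eq_sub_of_hasDerivAt (fun x _ => hf x) (hc.intervalIntegrable _ _)]
    exact intervalIntegral.norm_integral_le_integral_norm (hu (Nat.le_succ i))
  refine (Finset.sum_le_sum hstep).trans ?_
  rw [← ENNReal.ofReal_sum_of_nonneg]
  · refine ENNReal.ofReal_le_ofReal ?_
    rw [intervalIntegral.sum_integral_adjacent_intervals (fun k _ => hc.norm.intervalIntegrable _ _)]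
    refine le_trans ?_ hC
    refine intervalIntegral.integral_mono_interval (hus 0).1 (hu (Nat.zero_le n)) (hus n).2 ?_
      (hc.norm.intervalIntegrable _ _)
    exact Eventually.of_forall fun t => norm_nonneg _
  · intro i _
    exact intervalIntegral.integral_nonneg (hu (Nat.le_succ i)) (fun _ _ => norm_nonneg _)

/-- coefficients of the primitive divided by `z` -/
noncomputable def primC (c : ℕ → ℂ) : ℕ → ℂ := fun n => c n / (n + 1)

theorem primC_memH2 {c : ℕ → ℂ} (hc : CMemH2 c) : CMemH2 (primC c) := by
  refine Summable.of_nonneg_of_le (fun n => by positivity) (fun n => ?_) hc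
  gcongr
  rw [primC, norm_div]
  refine div_le_self (norm_nonneg _) ?_
  rw [show ((n:ℂ)+1) = ((n+1:ℕ):ℂ) by push_cast; ring, Complex.norm_natCast]
  simp

theorem primC_summable {c : ℕ → ℂ} (hc : CMemH2 c) : Summable (fun n => ‖primC c n‖) := by
  have h1 : Summable (fun n : ℕ => (1 / ((n:ℝ)+1) ^ 2)) := by
    have := (summable_nat_add_iff 1).2 (Real.summable_one_div_nat_pow.2 (by norm_num : 1 < 2))
    simpa using this
  refine Summable.of_nonneg_of_le (fun n => by positivity) (fun n => ?_) (h1.add hc)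
  rw [primC, norm_div, show ((n:ℂ)+1) = ((n+1:ℕ):ℂ) by push_cast; ring, Complex.norm_natCast]
  push_cast
  have h2 : (0:ℝ) ≤ 1/((n:ℝ)+1) := by positivity
  rw [div_eq_mul_one_div, ← one_div_pow]
  nlinarith [sq_nonneg (‖c n‖ - 1/((n:ℝ)+1)), sq_nonneg (‖c n‖ + 1/((n:ℝ)+1))]

/-- `G(z) = z * Σ c_n z^n/(n+1)` -/
noncomputable def primF (c : ℕ → ℂ) (z : ℂ) : ℂ := z * cEval (primC c) z

theorem primF_hasDerivAt {c : ℕ → ℂ} (hc : CMemH2 c) {z : ℂ} (hz : ‖z‖ < 1) :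
    HasDerivAt (primF c) (cEval c z) z := by
  have hz' : z ∈ Metric.ball (0:ℂ) 1 := by simpa using hz
  obtain ⟨ρ, hzρ, hρ⟩ := exists_between hz
  have hρ0 : 0 ≤ ρ := (norm_nonneg z).trans hzρ.le
  have hs : Summable (fun n => ρ ^ n * ‖c n‖) := by
    simpa [abs_of_nonneg hρ0] using cH_summable hc (z := (ρ:ℂ)) (by simpa [abs_of_nonneg hρ0] using hρ)
  have key := hasDerivAt_tsum_of_isPreconnected (𝕜 := ℂ) (F := ℂ) hs
    (t := Metric.ball (0:ℂ) ρ) (g := fun n z => z ^ (n+1) * primC c n) (g' := fun n z => z ^ n * c n)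
    (y₀ := 0) (y := z)
    Metric.isOpen_ball ((convex_ball (0:ℂ) ρ).isPreconnected) ?_ ?_ ?_ ?_ ?_
  · have e : primF c = fun z => ∑' n, z ^ (n+1) * primC c n := by
      ext w; rw [primF, cEval, ← tsum_mul_left]; congr 1; ext n; ring
    rw [e]; exact key
  · intro n y _
    have := (hasDerivAt_pow (n+1) y).mul_const (primC c n)
    refine this.congr_deriv ?_
    simp only [primC]
    have : ((n:ℂ)+1) ≠ 0 := by exact_mod_cast Nat.succ_ne_zero n
    push_cast; field_simp
  · intro n y hy
    rw [norm_mul, norm_pow]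
    have : ‖y‖ ≤ ρ := by simpa using (le_of_lt (by simpa using hy))
    gcongr
  · simpa using (norm_nonneg z).trans_lt hzρ
  · simp
  · simpa using hzρ

theorem primF_tendsto {c : ℕ → ℂ} (hc : CMemH2 c) {z : ℂ} (hz : ‖z‖ ≤ 1) {ι : Type*} {l : Filter ι}
    {w : ι → ℂ} (hw : Tendsto w l (𝓝 z)) (hw1 : ∀ᶠ i in l, ‖w i‖ ≤ 1) :
    Tendsto (fun i => primF c (w i)) l (𝓝 (primF c z)) := by
  refine hw.mul ?_
  refine tendsto_tsum_of_dominated_convergence (primC_summable hc) (fun k => ?_) ?_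
  · exact (hw.pow k).mul_const _
  · filter_upwards [hw1] with i hi k
    rw [norm_mul, norm_pow]
    have : ‖w i‖ ^ k ≤ 1 := pow_le_one₀ (norm_nonneg _) hi
    nlinarith [norm_nonneg (primC c k)]

theorem primF_bound {c : ℕ → ℂ} (hc : CMemH2 c) {z : ℂ} (hz : ‖z‖ ≤ 1) :
    ‖primF c z‖ ≤ ∑' n, ‖primC c n‖ := by
  have hb : ∀ n, ‖z ^ n * primC c n‖ ≤ ‖primC c n‖ := fun n => by
    rw [norm_mul, norm_pow]
    have : ‖z‖ ^ n ≤ 1 := pow_le_one₀ (norm_nonneg _) hz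
    nlinarith [norm_nonneg (primC c n)]
  rw [primF, norm_mul]
  have h1 : ‖cEval (primC c) z‖ ≤ ∑' n, ‖primC c n‖ :=
    tsum_of_norm_bounded (primC_summable hc).hasSum hb
  nlinarith [norm_nonneg (cEval (primC c) z), norm_nonneg z]

/-- the primitive along circles -/
theorem primF_circ_deriv {c : ℕ → ℂ} (hc : CMemH2 c) {r : ℝ} (h0 : 0 ≤ r) (h1 : r < 1) (t : ℝ) :
    HasDerivAt (fun t : ℝ => primF c (r * Complex.exp (t * Complex.I)))
      (Complex.I * ((r * Complex.exp (t * Complex.I)) * cEval c (r * Complex.exp (t * Complex.I)))) t := by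
  have hF := primF_hasDerivAt hc (z := r * Complex.exp (t * Complex.I))
    (by rw [norm_circ _ _ h0]; exact h1)
  have he : HasDerivAt (fun t : ℝ => (r:ℂ) * Complex.exp (t * Complex.I))
      (r * (Complex.exp (t * Complex.I) * Complex.I)) t := by
    have := ((Complex.ofRealCLM.hasDerivAt (x := t)).mul_const Complex.I).cexp.const_mul (r:ℂ)
    simpa using this
  have := hF.scomp t he
  have h2 := this.congr_deriv (g' := (Complex.I * ((r * Complex.exp (t * Complex.I)) * cEval c (r * Complex.exp (t * Complex.I))))) (by simp only [smul_eq_mul]; ring)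
  exact h2

theorem primF_circ_diff {c : ℕ → ℂ} (hc : CMemH2 c) :
    ∀ᵐ t ∂(volume.restrict (Set.Ico 0 (2 * Real.pi))),
      DifferentiableAt ℝ (fun t : ℝ => primF c (Complex.exp (t * Complex.I))) t := by
  have hpi := Real.pi_pos
  obtain ⟨C, hC⟩ : ∃ C : ℝ, ∀ r : ℝ, 0 ≤ r → r < 1 →
      eVariationOn (fun t : ℝ => primF c (r * Complex.exp (t * Complex.I)))
        (Set.Icc 0 (2 * Real.pi)) ≤ ENNReal.ofReal C := by
    refine ⟨2 * Real.pi + 2 * Real.pi * ∑' n, ‖c n‖ ^ 2, fun r h0 h1 => ?_⟩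
    have hcont := cH_cont_circ hc h0 h1
    refine eVar_le_of_deriv (primF_circ_deriv hc h0 h1) (by fun_prop) ?_
    have e1 : ∫ t in (0:ℝ)..2 * Real.pi, (1 + ‖cEval c (r * Complex.exp (t * Complex.I))‖ ^ 2)
        ≤ 2 * Real.pi + 2 * Real.pi * ∑' n, ‖c n‖ ^ 2 := by
      rw [intervalIntegral.integral_add (by simp) (Continuous.intervalIntegrable (by fun_prop) _ _)]
      have := cH_L2_bound hc h0 h1
      simp only [intervalIntegral.integral_const, smul_eq_mul]
      linarith
    refine le_trans (intervalIntegral.integral_mono_on (by positivity)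
      (Continuous.intervalIntegrable (by fun_prop) _ _)
      (Continuous.intervalIntegrable (by fun_prop) _ _) ?_) e1
    intro t _
    rw [norm_mul, norm_mul, norm_circ _ _ h0, Complex.norm_I, one_mul]
    have := norm_nonneg (cEval c (r * Complex.exp (t * Complex.I)))
    nlinarith [sq_nonneg (‖cEval c (r * Complex.exp (t * Complex.I))‖ - 1)]
  have hbv : BoundedVariationOn (fun t : ℝ => primF c (Complex.exp (t * Complex.I)))
      (Set.Icc 0 (2 * Real.pi)) := by
    have hle : eVariationOn (fun t : ℝ => primF c (Complex.exp (t * Complex.I)))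
      (Set.Icc 0 (2 * Real.pi)) ≤ ENNReal.ofReal C := by
      by_contra! hlt
      have := eVariationOn.lowerSemicontinuous_aux (α := ℝ) (E := ℂ) (ι := ℝ) (p := 𝓝[<] (1:ℝ))
        (f := fun t : ℝ => primF c (Complex.exp (t * Complex.I))) (s := Set.Icc 0 (2 * Real.pi))
        (F := fun (r t : ℝ) => primF c (r * Complex.exp (t * Complex.I))) ?_ hlt
      · have h2 : ∀ᶠ r in 𝓝[<] (1:ℝ), 0 ≤ r ∧ r < 1 := by
          filter_upwards [Ioo_mem_nhdsLT (zero_lt_one' ℝ)] with r hr using ⟨hr.1.le, hr.2⟩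
        obtain ⟨r, hr1, hr2, hr3⟩ := (this.and h2).exists
        exact absurd (hC r hr2 hr3) (not_le.2 hr1)
      · intro t _
        refine primF_tendsto hc (by simp [Complex.norm_exp_ofReal_mul_I]) ?_ ?_
        · have : Tendsto (fun r : ℝ => (r:ℂ) * Complex.exp (t * Complex.I)) (𝓝 1)
              (𝓝 (((1:ℝ):ℂ) * Complex.exp (t * Complex.I))) := by
            exact (Continuous.tendsto (by fun_prop) 1)
          simpa using this.mono_left nhdsWithin_le_nhds
        · filter_upwards [Ioo_mem_nhdsLT (zero_lt_one' ℝ)] with r hr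
          rw [norm_circ _ _ hr.1.le]; exact hr.2.le
    exact ne_top_of_le_ne_top ENNReal.ofReal_ne_top hle
  have := (show BoundedVariationOn _ (Set.uIcc 0 (2 * Real.pi)) by
    rw [Set.uIcc_of_le (by positivity)]; exact hbv).ae_differentiableAt_of_mem_uIcc
  rw [ae_restrict_iff' measurableSet_Ico]
  filter_upwards [this] with t ht hmem
  apply ht
  rw [Set.uIcc_of_le (by positivity)]
  exact ⟨hmem.1, hmem.2.le⟩

/-- minus derivative of the Poisson kernel, divided by `r` -/
noncomputable def kerK (r s : ℝ) : ℝ := 2 * (1 - r ^ 2) * Real.sin s / (1 - 2 * r * Real.cos s + r ^ 2) ^ 2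

theorem kerD_pos {r : ℝ} (h0 : 0 ≤ r) (h1 : r < 1) (s : ℝ) : 0 < 1 - 2 * r * Real.cos s + r ^ 2 := by
  have := Real.cos_le_one s
  nlinarith [mul_nonneg h0 (sub_nonneg.2 this), sq_pos_of_pos (sub_pos.2 h1)]

theorem kerK_cont {r : ℝ} (h0 : 0 ≤ r) (h1 : r < 1) : Continuous (kerK r) := by
  unfold kerK
  refine Continuous.div (by fun_prop) (by fun_prop) (fun s => (pow_pos (kerD_pos h0 h1 s) 2).ne')

theorem kerK_cauchy {r : ℝ} (h0 : 0 ≤ r) (h1 : r < 1) (s : ℝ) :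
    Complex.exp (s * Complex.I) * (1 / (Complex.exp (s * Complex.I) - r) ^ 2
      - 1 / (1 - r * Complex.exp (s * Complex.I)) ^ 2) = -Complex.I * (kerK r s : ℝ) := by
  have hD := kerD_pos h0 h1 s
  have hD' : ((1:ℂ) - 2 * r * Complex.cos s + r ^ 2) ≠ 0 := by exact_mod_cast hD.ne'
  have hz : Complex.exp (s * Complex.I) = Complex.cos s + Complex.sin s * Complex.I := by
    rw [Complex.exp_mul_I]
  have hsc := Complex.sin_sq_add_cos_sq (s:ℂ)
  have hI := Complex.I_sq
  have hz0 : Complex.exp (s * Complex.I) ≠ 0 := Complex.exp_ne_zero _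
  have hmul : (Complex.exp (s * Complex.I) - r) * (1 - r * Complex.exp (s * Complex.I)) =
      Complex.exp (s * Complex.I) * (1 - 2 * r * Complex.cos s + r ^ 2) := by
    rw [hz]
    linear_combination (r:ℂ) * hsc + (-(r:ℂ)*Complex.sin s^2) * hI
  have hne : (Complex.exp (s * Complex.I) - r) * (1 - r * Complex.exp (s * Complex.I)) ≠ 0 := by
    rw [hmul]; exact mul_ne_zero hz0 hD'
  have hA := left_ne_zero_of_mul hne
  have hB := right_ne_zero_of_mul hne
  rw [kerK]
  push_cast
  rw [div_sub_div _ _ (pow_ne_zero _ hA) (pow_ne_zero _ hB), ← mul_pow, hmul]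
  have hzz : (1 - Complex.exp (s * Complex.I)^2) = -2 * Complex.I * Complex.sin s * Complex.exp (s * Complex.I) := by
    rw [hz]
    linear_combination (-1:ℂ) * hsc + (Complex.sin s^2) * hI
  have hnum : (1 * (1 - ↑r * Complex.exp (s * Complex.I)) ^ 2 - (Complex.exp (s * Complex.I) - ↑r) ^ 2 * 1)
    = (1-(r:ℂ)^2) * (1 - Complex.exp (s * Complex.I)^2) := by ring
  rw [hnum, hzz]
  field_simp

theorem kerK_odd (r s : ℝ) : kerK r (-s) = - kerK r s := by
  simp [kerK]; ring

theorem kerK_int_zero (r : ℝ) : ∫ s in (-Real.pi)..Real.pi, kerK r s = 0 := by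
  have h : ∫ s in (-Real.pi)..Real.pi, kerK r (-s) = ∫ s in (-Real.pi)..Real.pi, kerK r s := by
    rw [intervalIntegral.integral_comp_neg]; simp
  simp only [kerK_odd, intervalIntegral.integral_neg] at h
  linarith

theorem kerK_repr {G : ℂ → ℂ} (hG : DiffContOnCl ℂ G (Metric.ball 0 1)) {r : ℝ} (h0 : 0 ≤ r)
    (h1 : r < 1) : ∃ A : ℂ, deriv G r = (2 * Real.pi : ℂ)⁻¹ * ∫ s in (-Real.pi)..Real.pi,
      (G (Complex.exp (s * Complex.I)) - A) * (-Complex.I * (kerK r s : ℝ)) := by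
  have hr : (r:ℂ) ∈ Metric.ball (0:ℂ) 1 := by simpa [abs_of_nonneg h0] using h1
  have hcl := hG.continuousOn_ball
  have hden : ∀ z ∈ Metric.closedBall (0:ℂ) 1, (1 - r * z) ≠ 0 := by
    intro z hz h
    have hz' : ‖z‖ ≤ 1 := by simpa using hz
    have : ‖(r:ℂ) * z‖ = 1 := by rw [← sub_eq_zero.1 h]; simp
    rw [norm_mul, Complex.norm_real, Real.norm_of_nonneg h0] at this
    nlinarith [norm_nonneg z]
  have hΦ : DiffContOnCl ℂ (fun z => dslope G r z - (z - r) * (G z - G r) / (1 - r * z) ^ 2)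
      (Metric.ball 0 1) := by
    refine ⟨?_, ?_⟩
    · refine ((Complex.differentiableOn_dslope (Metric.isOpen_ball.mem_nhds hr)).2 hG.1).sub ?_
      refine DifferentiableOn.div ?_ (by fun_prop) ?_
      · exact (DifferentiableOn.mul (by fun_prop) (hG.1.sub_const _))
      · exact fun z hz => pow_ne_zero _ (hden z (Metric.ball_subset_closedBall hz))
    · rw [closure_ball _ one_ne_zero]
      refine ContinuousOn.sub ((continuousOn_dslope (Metric.closedBall_mem_nhds_of_mem hr)).2
        ⟨hcl, hG.differentiableAt Metric.isOpen_ball hr⟩) ?_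
      refine ContinuousOn.div ?_ (by fun_prop) (fun z hz => pow_ne_zero _ (hden z hz))
      exact ContinuousOn.mul (by fun_prop) (hcl.sub continuousOn_const)
  have key := hΦ.circleIntegral_sub_inv_smul hr
  refine ⟨G r, ?_⟩
  simp only [sub_self, zero_mul, zero_div, sub_zero, dslope_same, smul_eq_mul] at key
  have hper : ∫ s in (-Real.pi)..Real.pi,
      (G (Complex.exp (s * Complex.I)) - G r) * (-Complex.I * (kerK r s : ℝ)) =
      ∫ s in (0:ℝ)..2 * Real.pi,
      (G (Complex.exp (s * Complex.I)) - G r) * (-Complex.I * (kerK r s : ℝ)) := by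
    have hp : Function.Periodic (fun s : ℝ => 
      (G (Complex.exp (s * Complex.I)) - G r) * (-Complex.I * (kerK r s : ℝ))) (2 * Real.pi) := by
      intro s
      have : Complex.exp (((s + 2 * Real.pi : ℝ):ℂ) * Complex.I) = Complex.exp (s * Complex.I) := by
        push_cast
        rw [add_mul, Complex.exp_add, Complex.exp_two_pi_mul_I, mul_one]
      simp only [this, kerK, Real.sin_add_two_pi, Real.cos_add_two_pi]
    have := hp.intervalIntegral_add_eq (-Real.pi) 0
    rw [zero_add] at this
    rw [← this]; congr 1; ring
  rw [hper]
  have hI : (∮ z in C(0, 1), (z - (r:ℂ))⁻¹ * (dslope G r z - (z - r) * (G z - G r) / (1 - r * z) ^ 2))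
    = Complex.I * ∫ s in (0:ℝ)..2 * Real.pi,
      (G (Complex.exp (s * Complex.I)) - G r) * (-Complex.I * (kerK r s : ℝ)) := by
    rw [circleIntegral, ← intervalIntegral.integral_const_mul]
    congr 1
    ext s
    rw [← kerK_cauchy h0 h1 s]
    simp only [deriv_circleMap, circleMap, Complex.ofReal_one, one_mul, zero_add, smul_eq_mul]
    set z := Complex.exp (s * Complex.I) with hz
    have hz1 : ‖z‖ = 1 := by rw [hz]; exact Complex.norm_exp_ofReal_mul_I s
    have hzr : z ≠ r := by
      intro h
      rw [h] at hz1
      rw [Complex.norm_real, Real.norm_of_nonneg h0] at hz1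
      linarith
    have hzr' : z - r ≠ 0 := sub_ne_zero.2 hzr
    have hd := hden z (by simp [hz1])
    rw [dslope_of_ne _ hzr, slope_def_field]
    field_simp
  rw [hI] at key
  have hpi : (Real.pi : ℂ) ≠ 0 := by exact_mod_cast Real.pi_ne_zero
  have := Complex.I_ne_zero
  have key2 : (∫ s in (0:ℝ)..2 * Real.pi,
      (G (Complex.exp (s * Complex.I)) - G r) * (-Complex.I * (kerK r s : ℝ))) = 2 * Real.pi * deriv G r := by
    apply mul_left_cancel₀ this
    rw [key]; ring
  rw [key2]
  field_simp

/-- the Poisson kernel -/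
noncomputable def kerP (r s : ℝ) : ℝ := (1 - r ^ 2) / (1 - 2 * r * Real.cos s + r ^ 2)

theorem kerP_deriv {r : ℝ} (h0 : 0 ≤ r) (h1 : r < 1) (s : ℝ) :
    HasDerivAt (fun s => -s * kerP r s) (r * (s * kerK r s) - kerP r s) s := by
  have hD := kerD_pos h0 h1 s
  have e1 : HasDerivAt (fun s : ℝ => 1 - 2 * r * Real.cos s + r ^ 2) (2 * r * Real.sin s) s := by
    have := (((Real.hasDerivAt_cos s).const_mul (2*r)).const_sub 1).add_const (r^2)
    refine this.congr_deriv (by ring)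
  have e2 : HasDerivAt (kerP r) (-(1 - r^2) * (2 * r * Real.sin s) / (1 - 2 * r * Real.cos s + r ^ 2)^2) s := by
    have := (e1.inv hD.ne').const_mul (1 - r^2)
    unfold kerP
    simp only [div_eq_mul_inv]
    refine this.congr_deriv (by ring)
  have := (hasDerivAt_neg s).mul e2
  refine this.congr_deriv ?_
  rw [kerK]; ring

theorem kerP_cont {r : ℝ} (h0 : 0 ≤ r) (h1 : r < 1) : Continuous (kerP r) := by
  unfold kerP
  refine Continuous.div (by fun_prop) (by fun_prop) (fun s => (kerD_pos h0 h1 s).ne')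

theorem kerP_int {r : ℝ} (h0 : 0 ≤ r) (h1 : r < 1) :
    ∫ s in (-Real.pi)..Real.pi, kerP r s = 2 * Real.pi := by
  have hr : (r:ℂ) ∈ Metric.ball (0:ℂ) 1 := by simpa [abs_of_nonneg h0] using h1
  have h := (diffContOnCl_const (c := (1:ℂ)) (s := Metric.ball (0:ℂ) 1)).circleAverage_poissonKernel_smul hr
  rw [Real.circleAverage] at h
  have hper : Function.Periodic (kerP r) (2 * Real.pi) := by
    intro s; simp [kerP]
  have h2 := hper.intervalIntegral_add_eq (-Real.pi) 0
  rw [zero_add, show -Real.pi + 2 * Real.pi = Real.pi by ring] at h2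
  rw [h2]
  have h3 : ∀ s : ℝ, (poissonKernel 0 (r:ℂ) • (fun _ : ℂ => (1:ℂ))) (circleMap 0 1 s) = (kerP r s : ℂ) := by
    intro s
    have e : ‖Complex.exp (s * Complex.I) - r‖ ^ 2 = 1 - 2 * r * Real.cos s + r ^ 2 := by
      rw [← Complex.normSq_eq_norm_sq, Complex.exp_mul_I, Complex.normSq_apply]
      simp [Complex.cos_ofReal_re, Complex.sin_ofReal_re]
      nlinarith [Real.sin_sq_add_cos_sq s]
    simp [poissonKernel_def, circleMap, kerP, Complex.norm_exp_ofReal_mul_I, e, abs_of_nonneg h0]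
  simp only [h3] at h
  rw [intervalIntegral.integral_ofReal] at h
  have hpi := Real.pi_pos
  simp only [Complex.real_smul] at h
  have h4 : (2 * Real.pi)⁻¹ * ∫ s in (0:ℝ)..2 * Real.pi, kerP r s = 1 := by exact_mod_cast h
  field_simp at h4
  linarith

theorem kerK_mass {r : ℝ} (h0 : 0 < r) (h1 : r < 1) :
    r * ∫ s in (-Real.pi)..Real.pi, s * kerK r s = 2 * Real.pi * (1 - (1 - r) / (1 + r)) := by
  have hc1 := kerK_cont h0.le h1
  have hc2 := kerP_cont h0.le h1
  have h := intervalIntegral.integral_eq_sub_of_hasDerivAt (a := -Real.pi) (b := Real.pi)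
    (fun s _ => kerP_deriv h0.le h1 s) (Continuous.intervalIntegrable (by fun_prop) _ _)
  rw [intervalIntegral.integral_sub (Continuous.intervalIntegrable (by fun_prop) _ _)
    (Continuous.intervalIntegrable (by fun_prop) _ _), kerP_int h0.le h1,
    intervalIntegral.integral_const_mul] at h
  have : r * ∫ s in (-Real.pi)..Real.pi, s * kerK r s = 2 * Real.pi - 2 * Real.pi * kerP r Real.pi := by
    have e : kerP r (-Real.pi) = kerP r Real.pi := by simp [kerP]
    rw [e] at h
    linarith
  rw [this, kerP, Real.cos_pi]
  have h2 : 1 + r ≠ 0 := by linarith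
  have : (1 - r^2) / (1 - 2 * r * (-1) + r^2) = (1 - r)/(1 + r) := by
    rw [div_eq_div_iff (by nlinarith) h2]; ring
  rw [this]; ring

theorem deriv_tendsto_of_circ {G : ℂ → ℂ} (hG : DiffContOnCl ℂ G (Metric.ball 0 1))
    (hd : DifferentiableAt ℝ (fun t : ℝ => G (Complex.exp (t * Complex.I))) 0) :
    ∃ L, Tendsto (fun r : ℝ => deriv G r) (𝓝[<] 1) (𝓝 L) := by
  have hpi := Real.pi_pos
  set g : ℝ → ℂ := fun t : ℝ => G (Complex.exp (t * Complex.I)) with hg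
  have hgc : Continuous g := by
    have := hG.continuousOn_ball
    exact this.comp_continuous (by fun_prop) (fun t => by simp [Complex.norm_exp_ofReal_mul_I])
  have hds : Continuous (dslope g 0) := by
    rw [← continuousOn_univ]
    exact (continuousOn_dslope univ_mem).2 ⟨hgc.continuousOn, hd⟩
  have hnear : ∀ᶠ r in 𝓝[<] (1:ℝ), 1/2 < r ∧ r < 1 := by
    filter_upwards [Ioo_mem_nhdsLT (show (1/2:ℝ) < 1 by norm_num)] with r hr using hr
  have hpeak : Tendsto (fun r : ℝ => ∫ s in Set.Icc (-Real.pi) Real.pi,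
      ((2 * Real.pi)⁻¹ * (s * kerK r s)) • dslope g 0 s) (𝓝[<] 1) (𝓝 (dslope g 0 0)) := by
    refine tendsto_setIntegral_peak_smul_of_integrableOn_of_tendsto (x₀ := 0)
      measurableSet_Icc measurableSet_Icc subset_rfl self_mem_nhdsWithin ?_ ?_ ?_ ?_ ?_ ?_ ?_
    · simp
    · filter_upwards [hnear] with r hr s hs
      have hD := kerD_pos (by linarith) hr.2 s
      have hsin : 0 ≤ s * Real.sin s := by
        rcases le_total 0 s with h | h
        · exact mul_nonneg h (Real.sin_nonneg_of_nonneg_of_le_pi h hs.2)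
        · exact mul_nonneg_of_nonpos_of_nonpos h (Real.sin_nonpos_of_nonpos_of_neg_pi_le h hs.1)
      have : s * kerK r s = (2 * (1 - r^2)) * (s * Real.sin s) / (1 - 2 * r * Real.cos s + r ^ 2) ^ 2 := by
        rw [kerK]; ring
      rw [this]
      have : 0 ≤ 1 - r^2 := by nlinarith
      positivity
    · intro u hu h0u
      obtain ⟨δ, hδ, hball⟩ := Metric.isOpen_iff.1 hu 0 h0u
      set δ' := min δ Real.pi
      have hδ' : 0 < δ' := lt_min hδ hpi
      have hcos : Real.cos δ' < 1 := by
        rw [← Real.cos_zero]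
        exact Real.cos_lt_cos_of_nonneg_of_le_pi le_rfl (min_le_right _ _) hδ'
      have hm : 0 < 1 - Real.cos δ' := by linarith
      have hlim : Tendsto (fun r : ℝ => (1 - r^2) / (1 - Real.cos δ')^2) (𝓝[<] 1) (𝓝 0) := by
        have : Tendsto (fun r : ℝ => (1 - r^2) / (1 - Real.cos δ')^2) (𝓝 1) (𝓝 ((1 - 1^2)/ (1 - Real.cos δ')^2)) :=
          Continuous.tendsto (by fun_prop) 1
        simpa using this.mono_left nhdsWithin_le_nhds
      rw [Metric.tendstoUniformlyOn_iff]
      intro ε hε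
      filter_upwards [hnear, hlim.eventually_lt_const hε] with r hr hlt s hs
      have hs1 : |s| ≤ Real.pi := abs_le.2 hs.1
      have hs2 : δ' ≤ |s| := by
        by_contra! hh
        exact hs.2 (hball (by simpa using hh.trans_le (min_le_left _ _)))
      have hcs : Real.cos s ≤ Real.cos δ' := by
        rw [← Real.cos_abs s]
        exact Real.cos_le_cos_of_nonneg_of_le_pi hδ'.le hs1 hs2
      have hDge : 1 - Real.cos δ' ≤ 1 - 2 * r * Real.cos s + r ^ 2 := by
        nlinarith [Real.cos_le_one s, Real.neg_one_le_cos s]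
      rw [Pi.zero_apply, dist_zero_left, Real.norm_eq_abs]
      refine lt_of_le_of_lt ?_ hlt
      rw [kerK, abs_mul, abs_mul, abs_div, abs_mul, abs_of_pos (show 0 < (2*Real.pi)⁻¹ by positivity),
        abs_of_nonneg (show 0 ≤ 2 * (1 - r^2) by nlinarith), abs_sq]
      have hnum : (2*Real.pi)⁻¹ * (|s| * (2 * (1 - r^2) * |Real.sin s|)) ≤ 1 - r^2 := by
        have h1 : |s| * |Real.sin s| ≤ Real.pi * 1 :=
          mul_le_mul hs1 (Real.abs_sin_le_one s) (abs_nonneg _) hpi.le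
        have h2 : 0 ≤ 1 - r^2 := by nlinarith
        calc _ = (1 - r^2) * ((|s| * |Real.sin s|) / Real.pi) := by field_simp
          _ ≤ (1 - r^2) * 1 := by
            gcongr
            rw [div_le_one hpi]; linarith
          _ = _ := mul_one _
      rw [← mul_div_assoc, ← mul_div_assoc]
      have h2 : 0 ≤ 1 - r^2 := by nlinarith
      gcongr
    · have : Tendsto (fun r : ℝ => (1 - (1 - r) / (1 + r)) / r) (𝓝[<] 1) (𝓝 1) := by
        have : ContinuousAt (fun r : ℝ => (1 - (1 - r) / (1 + r)) / r) 1 := by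
          fun_prop (disch := norm_num)
        have h := this.tendsto
        norm_num at h
        exact h.mono_left nhdsWithin_le_nhds
      refine this.congr' ?_
      filter_upwards [hnear] with r hr
      have h0 : 0 < r := by linarith
      have := kerK_mass h0 hr.2
      rw [integral_Icc_eq_integral_Ioc, ← intervalIntegral.integral_of_le (by linarith),
        intervalIntegral.integral_const_mul, div_eq_iff h0.ne']
      rw [mul_assoc, mul_comm _ r, this]
      field_simp
    · filter_upwards [hnear] with r hr
      have := kerK_cont (by linarith) hr.2
      exact Continuous.aestronglyMeasurable (by fun_prop)
    · exact hds.continuousOn.integrableOn_Icc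
    · exact hds.continuousWithinAt
  refine ⟨-Complex.I * dslope g 0 0, ?_⟩
  refine (hpeak.const_mul (-Complex.I)).congr' ?_
  filter_upwards [hnear] with r hr
  have h0 : 0 < r := by linarith
  obtain ⟨A, hA⟩ := kerK_repr hG h0.le hr.2
  have hkc := kerK_cont h0.le hr.2
  have hgc' : Continuous (fun s : ℝ => G (Complex.exp (s * Complex.I))) := hgc
  have hkc' : Continuous (fun s : ℝ => -Complex.I * ((kerK r s : ℝ) : ℂ)) := by fun_prop
  have hq1 : Continuous (fun s : ℝ => (G (Complex.exp (s * Complex.I)) - A) * (-Complex.I * ((kerK r s : ℝ) : ℂ))) :=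
    (hgc'.sub continuous_const).mul hkc'
  have hq2 : Continuous (fun s : ℝ => (g 0 - A) * (-Complex.I * ((kerK r s : ℝ) : ℂ))) :=
    continuous_const.mul hkc'
  have hz : ∫ s in (-Real.pi)..Real.pi, (g 0 - A) * (-Complex.I * (kerK r s : ℝ)) = 0 := by
    rw [intervalIntegral.integral_const_mul, intervalIntegral.integral_const_mul,
      intervalIntegral.integral_ofReal, kerK_int_zero]; simp
  rw [hA, ← sub_zero (∫ s in (-Real.pi)..Real.pi, _), ← hz, ← intervalIntegral.integral_sub
    (Continuous.intervalIntegrable hq1 _ _) (Continuous.intervalIntegrable hq2 _ _),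
    integral_Icc_eq_integral_Ioc, ← intervalIntegral.integral_of_le (by linarith),
    ← intervalIntegral.integral_const_mul, ← intervalIntegral.integral_const_mul]
  congr 1
  ext s
  have := sub_smul_dslope g 0 s
  rw [sub_zero] at this
  change _ = (2 * (Real.pi:ℂ))⁻¹ * ((g s - A) * (-Complex.I * (kerK r s : ℝ)) - (g 0 - A) * (-Complex.I * (kerK r s : ℝ)))
  rw [← sub_mul, show g s - A - (g 0 - A) = g s - g 0 by ring, ← this]
  simp only [Complex.real_smul]
  push_cast
  ring

/-- Fatou's theorem for `H²` -/
theorem fatou_radial {c : ℕ → ℂ} (hc : CMemH2 c) :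
    ∀ᵐ t : ℝ ∂(volume.restrict (Set.Ico 0 (2 * Real.pi))),
      ∃ L : ℂ, Tendsto (fun r : ℝ => cEval c (r * Complex.exp (t * Complex.I))) (𝓝[<] 1) (𝓝 L) := by
  filter_upwards [primF_circ_diff hc] with t ht
  set e := Complex.exp (t * Complex.I) with he
  have he1 : ‖e‖ = 1 := Complex.norm_exp_ofReal_mul_I t
  have hG : DiffContOnCl ℂ (fun z => primF c (e * z)) (Metric.ball 0 1) := by
    refine ⟨?_, ?_⟩
    · intro z hz
      have : ‖e * z‖ < 1 := by rw [norm_mul, he1, one_mul]; simpa using hz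
      have h1 := (primF_hasDerivAt hc this).differentiableAt
      exact (DifferentiableAt.comp z h1 (by fun_prop)).differentiableWithinAt
    · rw [closure_ball _ one_ne_zero]
      intro z hz
      have hb : ∀ w ∈ Metric.closedBall (0:ℂ) 1, ‖e * w‖ ≤ 1 := fun w hw => by
        rw [norm_mul, he1, one_mul]; simpa using hw
      refine primF_tendsto hc (hb z hz) ?_ ?_
      · exact (Continuous.tendsto (by fun_prop) z).mono_left nhdsWithin_le_nhds
      · filter_upwards [self_mem_nhdsWithin] with w hw using hb w hw
  obtain ⟨L, hL⟩ := deriv_tendsto_of_circ hG (by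
    have h2 : DifferentiableAt ℝ (fun t : ℝ => primF c (Complex.exp (t * Complex.I))) (t + 0) := by
      rw [add_zero]; exact ht
    have := DifferentiableAt.comp (0:ℝ) h2 ((differentiableAt_id).const_add t)
    refine this.congr_of_eventuallyEq (Eventually.of_forall fun s => ?_)
    simp only [Function.comp_apply, id]
    push_cast
    rw [add_mul, Complex.exp_add])
  refine ⟨e⁻¹ * L, ?_⟩
  refine (hL.const_mul e⁻¹).congr' ?_
  filter_upwards [Ioo_mem_nhdsLT (zero_lt_one' ℝ)] with r hr
  have hlt : ‖e * r‖ < 1 := by rw [norm_mul, he1, one_mul, Complex.norm_real, Real.norm_of_nonneg hr.1.le]; exact hr.2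
  have h1 := (primF_hasDerivAt hc hlt).comp (r:ℂ) ((hasDerivAt_id (r:ℂ)).const_mul e)
  have h2 : deriv (fun z => primF c (e * z)) r = cEval c (e * r) * (e * 1) := h1.deriv
  rw [h2, mul_comm (r:ℂ)]
  have : e ≠ 0 := Complex.exp_ne_zero _
  field_simp

theorem vol_le_of_antilip {f : ℝ → ℂ} {A : Set ℝ} {K : NNReal}
    (h : ∀ a ∈ A, ∀ b ∈ A, dist a b ≤ K * dist (f a) (f b)) :
    volume A ≤ K * μH[1] (f '' A) := by
  have hinj : Set.InjOn f A := by
    intro a ha b hb hab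
    have := h a ha b hb
    rw [hab, dist_self, mul_zero] at this
    exact dist_le_zero.1 this
  set g := Function.invFunOn f A
  have hg : ∀ a ∈ A, g (f a) = a := fun a ha => hinj.leftInvOn_invFunOn ha
  have hl : LipschitzOnWith K g (f '' A) := by
    refine LipschitzOnWith.of_dist_le_mul ?_
    rintro _ ⟨a, ha, rfl⟩ _ ⟨b, hb, rfl⟩
    rw [hg a ha, hg b hb]; exact h a ha b hb
  have := hl.hausdorffMeasure_image_le (d := 1) zero_le_one
  have e : g '' (f '' A) = A := by
    rw [Set.image_image]
    conv_rhs => rw [← Set.image_id A]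
    exact Set.image_congr fun a ha => hg a ha
  rw [e, ENNReal.rpow_one, hausdorffMeasure_real] at this
  exact this

noncomputable def eC (t : ℝ) : ℂ := Complex.exp (t * Complex.I)

theorem eC_norm (t : ℝ) : ‖eC t‖ = 1 := Complex.norm_exp_ofReal_mul_I t

theorem eC_dist (a b : ℝ) : dist (eC a) (eC b) = 2 * |Real.sin ((a - b)/2)| := by
  have : eC a - eC b = eC b * (Complex.exp (Complex.I * ((a - b : ℝ) : ℂ)) - 1) := by
    simp only [eC]
    rw [mul_sub, ← Complex.exp_add, mul_one]
    congr 2; push_cast; ring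
  rw [dist_eq_norm, this, norm_mul, eC_norm, one_mul, Complex.norm_exp_I_mul_ofReal_sub_one]
  simp

theorem eC_lip : LipschitzWith 1 eC := by
  refine LipschitzWith.of_dist_le_mul fun a b => ?_
  rw [eC_dist, Real.dist_eq]
  have := Real.abs_sin_le_abs (x := (a-b)/2)
  rw [abs_div, abs_two] at this
  simp; linarith

theorem eC_antilip {a b : ℝ} (h : |a - b| ≤ Real.pi) :
    dist a b ≤ 2 * dist (eC a) (eC b) := by
  have hpi := Real.pi_pos
  rw [eC_dist, Real.dist_eq]
  have h1 : |Real.sin ((a-b)/2)| = Real.sin (|a-b|/2) := by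
    rw [← abs_of_nonneg (Real.sin_nonneg_of_nonneg_of_le_pi (x := |a-b|/2) (by positivity) (by linarith))]
    rcases abs_cases (a-b) with ⟨h, _⟩ | ⟨h, _⟩
    · rw [h]
    · rw [h, neg_div, Real.sin_neg, abs_neg]
  have h2 := Real.mul_le_sin (x := |a-b|/2) (by positivity) (by linarith)
  rw [h1]
  have h3 : 2 / Real.pi ≥ 1/2 := by
    rw [ge_iff_le, div_le_div_iff₀ (by norm_num) hpi]; linarith [Real.pi_le_four]
  nlinarith [abs_nonneg (a-b)]

theorem eC_surj {z : ℂ} (hz : ‖z‖ = 1) : ∃ t ∈ Set.Ico 0 (2 * Real.pi), eC t = z := by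
  have h := Complex.norm_mul_exp_arg_mul_I z
  rw [hz, Complex.ofReal_one, one_mul] at h
  have h1 := Complex.neg_pi_lt_arg z
  have h2 := Complex.arg_le_pi z
  have hpi := Real.pi_pos
  by_cases h0 : 0 ≤ z.arg
  · exact ⟨z.arg, ⟨h0, by linarith⟩, h⟩
  · refine ⟨z.arg + 2 * Real.pi, ⟨by linarith, by linarith⟩, ?_⟩
    rw [eC]; push_cast
    rw [add_mul, Complex.exp_add, h, Complex.exp_two_pi_mul_I, mul_one]

/-- Möbius map -/
noncomputable def tauC (w z : ℂ) : ℂ := (1 - z * (starRingEnd ℂ) w)⁻¹ * (w - z)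

theorem tauC_den {w z : ℂ} (hw : ‖w‖ < 1) (hz : ‖z‖ ≤ 1) :
    1 - ‖w‖ ≤ ‖1 - z * (starRingEnd ℂ) w‖ := by
  have h1 : ‖z * (starRingEnd ℂ) w‖ ≤ ‖w‖ := by
    rw [norm_mul, RCLike.norm_conj]; nlinarith [norm_nonneg w]
  have := norm_sub_norm_le (1:ℂ) (z * (starRingEnd ℂ) w)
  rw [norm_one] at this; linarith

theorem tauC_den_ne {w z : ℂ} (hw : ‖w‖ < 1) (hz : ‖z‖ ≤ 1) :
    1 - z * (starRingEnd ℂ) w ≠ 0 := by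
  have := tauC_den hw hz
  intro h; rw [h, norm_zero] at this; linarith

theorem tauC_normSq {w z : ℂ} : 
    ‖1 - z * (starRingEnd ℂ) w‖^2 - ‖w - z‖^2 = (1 - ‖w‖^2) * (1 - ‖z‖^2) := by
  simp only [← Complex.normSq_eq_norm_sq, Complex.normSq_apply]
  simp; ring

theorem tauC_norm_le {w z : ℂ} (hw : ‖w‖ < 1) (hz : ‖z‖ ≤ 1) : ‖tauC w z‖ ≤ 1 := by
  have h1 := tauC_den hw hz
  have h2 := tauC_normSq (w := w) (z := z)
  have h3 : 0 < ‖1 - z * (starRingEnd ℂ) w‖ := by linarith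
  rw [tauC, norm_mul, norm_inv, inv_mul_le_iff₀ h3, mul_one]
  refine abs_le_of_sq_le_sq' ?_ h3.le |>.2
  nlinarith [mul_nonneg (show 0 ≤ 1 - ‖w‖^2 by nlinarith [norm_nonneg w]) (show 0 ≤ 1 - ‖z‖^2 by nlinarith [norm_nonneg z])]

theorem tauC_norm_eq {w z : ℂ} (hw : ‖w‖ < 1) (hz : ‖z‖ = 1) : ‖tauC w z‖ = 1 := by
  have h1 := tauC_den hw hz.le
  have h2 := tauC_normSq (w := w) (z := z)
  have h3 : 0 < ‖1 - z * (starRingEnd ℂ) w‖ := by linarith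
  rw [tauC, norm_mul, norm_inv]
  have : ‖w - z‖ = ‖1 - z * (starRingEnd ℂ) w‖ := by
    rw [hz] at h2
    have : ‖w - z‖^2 = ‖1 - z * (starRingEnd ℂ) w‖^2 := by linarith
    exact (pow_left_inj₀ (norm_nonneg _) (norm_nonneg _) two_ne_zero).1 this
  rw [this, inv_mul_cancel₀ h3.ne']

theorem tauC_invol {w z : ℂ} (hw : ‖w‖ < 1) (hz : ‖z‖ ≤ 1) : tauC w (tauC w z) = z := by
  have h1 := tauC_den_ne hw hz
  have h2 := tauC_den_ne hw (tauC_norm_le hw hz)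
  rw [tauC, inv_mul_eq_iff_eq_mul₀ h2]
  rw [tauC]
  field_simp
  ring

theorem tauC_zero (w : ℂ) : tauC w 0 = w := by simp [tauC]

theorem tauC_lip {w : ℂ} (hw : ‖w‖ < 1) : ∃ K : NNReal, LipschitzOnWith K (tauC w) (Metric.closedBall 0 1) := by
  have hd : 0 < 1 - ‖w‖ := by linarith
  refine ⟨⟨2 / (1 - ‖w‖)^2, by positivity⟩, LipschitzOnWith.of_dist_le_mul ?_⟩
  intro x hx y hy
  have hx' : ‖x‖ ≤ 1 := by simpa using hx
  have hy' : ‖y‖ ≤ 1 := by simpa using hy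
  have h1 := tauC_den_ne hw hx'
  have h2 := tauC_den_ne hw hy'
  have e : tauC w x - tauC w y = (w * (starRingEnd ℂ) w - 1) * (x - y) /
      ((1 - x * (starRingEnd ℂ) w) * (1 - y * (starRingEnd ℂ) w)) := by
    rw [tauC, tauC, eq_div_iff (mul_ne_zero h1 h2), sub_mul]
    rw [show (1 - x * (starRingEnd ℂ) w)⁻¹ * (w - x) * ((1 - x * (starRingEnd ℂ) w) * (1 - y * (starRingEnd ℂ) w)) = ((1 - x * (starRingEnd ℂ) w)⁻¹ * (1 - x * (starRingEnd ℂ) w)) * ((w - x) * (1 - y * (starRingEnd ℂ) w)) by ring,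
      show (1 - y * (starRingEnd ℂ) w)⁻¹ * (w - y) * ((1 - x * (starRingEnd ℂ) w) * (1 - y * (starRingEnd ℂ) w)) = ((1 - y * (starRingEnd ℂ) w)⁻¹ * (1 - y * (starRingEnd ℂ) w)) * ((w - y) * (1 - x * (starRingEnd ℂ) w)) by ring,
      inv_mul_cancel₀ h1, inv_mul_cancel₀ h2]
    ring
  rw [dist_eq_norm, e, norm_div, norm_mul, norm_mul, dist_eq_norm]
  have h3 := tauC_den hw hx'
  have h4 := tauC_den hw hy'
  have h5 : ‖w * (starRingEnd ℂ) w - 1‖ ≤ 2 := by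
    refine (norm_sub_le _ _).trans ?_
    rw [norm_mul, RCLike.norm_conj, norm_one]; nlinarith [norm_nonneg w]
  change _ ≤ 2 / (1 - ‖w‖)^2 * ‖x - y‖
  rw [div_mul_eq_mul_div]
  rw [sq]
  gcongr

noncomputable abbrev mC : Measure ℝ := volume.restrict (Set.Ico 0 (2 * Real.pi))

theorem tau_set_le {w : ℂ} (hw : ‖w‖ < 1) : ∃ K : NNReal, ∀ E : Set ℂ,
    mC {θ | tauC w (eC θ) ∈ E} ≤ K * mC {t | eC t ∈ E} := by
  obtain ⟨K, hK⟩ := tauC_lip hw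
  refine ⟨4 * K, fun E => ?_⟩
  have hpi := Real.pi_pos
  have hL : ∀ S : Set ℝ, (∀ a ∈ S, ∀ b ∈ S, |a - b| ≤ Real.pi) → S ⊆ {θ | tauC w (eC θ) ∈ E} →
      volume S ≤ 2 * K * mC {t | eC t ∈ E} := by
    intro S hS hSE
    have h1 : volume S ≤ (2:NNReal) * μH[1] (eC '' S) :=
      vol_le_of_antilip fun a ha b hb => eC_antilip (hS a ha b hb)
    have h2 : eC '' S ⊆ tauC w '' (eC '' ({t | eC t ∈ E} ∩ Set.Ico 0 (2 * Real.pi))) := by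
      rintro _ ⟨θ, hθ, rfl⟩
      refine ⟨tauC w (eC θ), ?_, tauC_invol hw (eC_norm θ).le⟩
      have hn := tauC_norm_eq hw (eC_norm θ)
      obtain ⟨t, ht, htt⟩ : ∃ t ∈ Set.Ico 0 (2 * Real.pi), eC t = tauC w (eC θ) := by
        exact eC_surj hn
      exact ⟨t, ⟨by rw [Set.mem_ofPred_eq, htt]; exact hSE hθ, ht⟩, htt⟩
    have h3 : μH[1] (eC '' ({t | eC t ∈ E} ∩ Set.Ico 0 (2 * Real.pi))) ≤ mC {t | eC t ∈ E} := by
      refine (eC_lip.hausdorffMeasure_image_le zero_le_one _).trans ?_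
      rw [hausdorffMeasure_real, Measure.restrict_apply' measurableSet_Ico]
      simp
    have h4 := (hK.mono (s := eC '' ({t | eC t ∈ E} ∩ Set.Ico 0 (2 * Real.pi))) (by
      rintro _ ⟨t, _, rfl⟩; simp [eC_norm])).hausdorffMeasure_image_le (d := 1) zero_le_one
    rw [ENNReal.rpow_one] at h4
    calc volume S ≤ (2:NNReal) * μH[1] (eC '' S) := h1
      _ ≤ 2 * (K * mC {t | eC t ∈ E}) := by
        push_cast
        gcongr
        refine (measure_mono h2).trans (h4.trans ?_)
        gcongr
      _ = _ := by ring
  set S := {θ | tauC w (eC θ) ∈ E}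
  have hS : S ∩ Set.Ico 0 (2 * Real.pi) = (S ∩ Set.Ico 0 Real.pi) ∪ (S ∩ Set.Ico Real.pi (2 * Real.pi)) := by
    rw [← Set.inter_union_distrib_left, Set.Ico_union_Ico_eq_Ico hpi.le (by linarith)]
  rw [Measure.restrict_apply' measurableSet_Ico, hS]
  refine (measure_union_le _ _).trans ?_
  refine (add_le_add (hL _ ?_ Set.inter_subset_left) (hL _ ?_ Set.inter_subset_left)).trans ?_
  · rintro a ⟨_, ha⟩ b ⟨_, hb⟩
    rw [abs_le]; constructor <;> linarith [ha.1, ha.2, hb.1, hb.2]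
  · rintro a ⟨_, ha⟩ b ⟨_, hb⟩
    rw [abs_le]; constructor <;> linarith [ha.1, ha.2, hb.1, hb.2]
  · push_cast
    apply le_of_eq
    ring

theorem tau_ae {w : ℂ} (hw : ‖w‖ < 1) {P : ℂ → Prop} (h : ∀ᵐ t ∂mC, P (eC t)) :
    ∀ᵐ θ ∂mC, P (tauC w (eC θ)) := by
  obtain ⟨K, hK⟩ := tau_set_le hw
  have := hK {z | ¬ P z}
  rw [ae_iff] at h ⊢
  have h' : mC {t | eC t ∈ {z | ¬ P z}} = 0 := h
  rw [h', mul_zero] at this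
  exact le_antisymm this (zero_le)

theorem tauC_eC_cont {w : ℂ} (hw : ‖w‖ < 1) : Continuous fun θ => tauC w (eC θ) := by
  have h := eC_lip.continuous
  unfold tauC
  exact Continuous.mul (Continuous.inv₀ (by fun_prop) fun θ => tauC_den_ne hw (eC_norm θ).le) (by fun_prop)

theorem tau_lintegral {w : ℂ} (hw : ‖w‖ < 1) : ∃ K : NNReal, ∀ h : ℂ → ℝ≥0∞, Measurable h →
    ∫⁻ θ, h (tauC w (eC θ)) ∂mC ≤ K * ∫⁻ t, h (eC t) ∂mC := by
  obtain ⟨K, hK⟩ := tau_set_le hw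
  refine ⟨K, fun h hh => ?_⟩
  have m1 := (tauC_eC_cont hw).measurable
  have m2 := eC_lip.continuous.measurable
  have hle : Measure.map (fun θ => tauC w (eC θ)) mC ≤ (K:ℝ≥0∞) • Measure.map eC mC := by
    refine Measure.le_iff.2 fun s hs => ?_
    rw [Measure.map_apply m1 hs, Measure.smul_apply, Measure.map_apply m2 hs]
    exact hK s
  have := lintegral_mono' hle (le_refl h)
  rw [lintegral_smul_measure, lintegral_map hh m1, lintegral_map hh m2] at this
  exact this

theorem log_le_eps {ε x : ℝ} (hε : 0 < ε) (hx : 0 < x) :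
    Real.log x ≤ ε * x ^ 2 + (-(1/2) - Real.log (2 * ε) / 2) := by
  have h1 := Real.log_le_sub_one_of_pos (show 0 < 2 * ε * x ^ 2 by positivity)
  rw [Real.log_mul (by positivity) (by positivity), Real.log_pow] at h1
  push_cast at h1
  linarith

theorem log_fatou {μ : Measure ℝ} [IsFiniteMeasure μ] {v : ℕ → ℝ → ℂ} {u : ℝ → ℂ} {B : ℝ}
    {l : ℕ → ℝ} {l0 : ℝ}
    (hm : ∀ n, AEStronglyMeasurable (v n) μ)
    (hlim : ∀ᵐ t ∂μ, Tendsto (fun n => v n t) atTop (𝓝 (u t)))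
    (hne : ∀ n, ∀ᵐ t ∂μ, v n t ≠ 0)
    (hli : ∀ n, Integrable (fun t => Real.log ‖v n t‖) μ)
    (hsq : ∀ n, Integrable (fun t => ‖v n t‖ ^ 2) μ)
    (hB : ∀ n, ∫ t, ‖v n t‖ ^ 2 ∂μ ≤ B)
    (hl : ∀ n, l n ≤ ∫ t, Real.log ‖v n t‖ ∂μ) (hl0 : Tendsto l atTop (𝓝 l0)) :
    (∀ᵐ t ∂μ, u t ≠ 0) ∧ Integrable (fun t => Real.log ‖u t‖) μ ∧
      Integrable (fun t => ‖u t‖ ^ 2) μ ∧ l0 ≤ ∫ t, Real.log ‖u t‖ ∂μ := by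
  have hum : AEStronglyMeasurable u μ := aestronglyMeasurable_of_tendsto_ae atTop hm hlim
  -- square integrability
  have hB0 : 0 ≤ B := le_trans (integral_nonneg fun t => by positivity) (hB 0)
  have hsqu : Integrable (fun t => ‖u t‖ ^ 2) μ := by
    refine ⟨(hum.norm.pow 2), ?_⟩
    have h1 : ∫⁻ t, ENNReal.ofReal (‖u t‖ ^ 2) ∂μ ≤ ENNReal.ofReal B := by
      calc ∫⁻ t, ENNReal.ofReal (‖u t‖ ^ 2) ∂μ
          ≤ ∫⁻ t, liminf (fun n => ENNReal.ofReal (‖v n t‖ ^ 2)) atTop ∂μ := by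
            refine lintegral_mono_ae ?_
            filter_upwards [hlim] with t ht
            have : Tendsto (fun n => ENNReal.ofReal (‖v n t‖ ^ 2)) atTop (𝓝 (ENNReal.ofReal (‖u t‖ ^ 2))) :=
              (ENNReal.continuous_ofReal.tendsto _).comp ((ht.norm).pow 2)
            rw [this.liminf_eq]
        _ ≤ liminf (fun n => ∫⁻ t, ENNReal.ofReal (‖v n t‖ ^ 2) ∂μ) atTop :=
            lintegral_liminf_le' fun n => ((hm n).norm.pow 2).aemeasurable.ennreal_ofReal
        _ ≤ ENNReal.ofReal B := by
            refine liminf_le_of_le (by isBoundedDefault) fun b hb => ?_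
            obtain ⟨n, hn⟩ := hb.exists
            refine hn.trans ?_
            rw [← ofReal_integral_eq_lintegral_ofReal (hsq n) (Eventually.of_forall fun t => by positivity)]
            exact ENNReal.ofReal_le_ofReal (hB n)
    rw [HasFiniteIntegral]
    refine lt_of_le_of_lt ?_ (h1.trans_lt ENNReal.ofReal_lt_top)
    refine lintegral_mono fun t => ?_
    rw [← ofReal_norm, Real.norm_of_nonneg (by positivity)]
  -- main
  set M := μ.real Set.univ
  set C : ℝ → ℝ := fun ε => -(1/2) - Real.log (2 * ε) / 2 with hC
  set φ : ℝ → ℝ → ℝ := fun ε x => ε * x ^ 2 + C ε - Real.log x with hφ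
  have hφ0 : ∀ ε, 0 < ε → ∀ x, 0 < x → 0 ≤ φ ε x := fun ε hε x hx => by
    have := log_le_eps hε hx; simp only [hφ, hC]; linarith
  have hφi : ∀ ε n, Integrable (fun t => φ ε ‖v n t‖) μ := fun ε n =>
    (((hsq n).const_mul ε).add (integrable_const _)).sub (hli n)
  have hφint : ∀ ε, 0 < ε → ∀ n, ∫ t, φ ε ‖v n t‖ ∂μ ≤ ε * B + M * C ε - l n := by
    intro ε hε n
    simp only [hφ]
    have hI : Integrable (fun t => ε * ‖v n t‖ ^ 2 + C ε) μ := ((hsq n).const_mul ε).add (integrable_const _)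
    rw [integral_sub hI (hli n),
      integral_add ((hsq n).const_mul ε) (integrable_const _), integral_const_mul, integral_const,
      smul_eq_mul]
    have := mul_le_mul_of_nonneg_left (hB n) hε.le
    linarith [hl n]
  set ψ : ℝ → ℂ → ℝ≥0∞ := fun ε z => if z = 0 then ⊤ else ENNReal.ofReal (φ ε ‖z‖) with hψ
  have hcont : ∀ ε, 0 < ε → Continuous (ψ ε) := by
    intro ε hε
    rw [continuous_iff_continuousAt]
    intro z
    by_cases hz : z = 0
    · subst hz
      have h1 : Tendsto (fun z : ℂ => φ ε ‖z‖) (𝓝[≠] 0) atTop := by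
        have h2 : Tendsto (fun z : ℂ => Real.log ‖z‖) (𝓝[≠] 0) atBot :=
          Real.tendsto_log_nhdsGT_zero.comp (tendsto_norm_nhdsNE_zero)
        have h3 : Tendsto (fun z : ℂ => ε * ‖z‖^2 + C ε) (𝓝[≠] 0) (𝓝 (ε * ‖(0:ℂ)‖^2 + C ε)) :=
          (Continuous.tendsto (by fun_prop) 0).mono_left nhdsWithin_le_nhds
        exact (h3.add_atTop (tendsto_neg_atBot_atTop.comp h2))
      have h4 : Tendsto (ψ ε) (𝓝[≠] 0) (𝓝 ⊤) := by
        refine (ENNReal.tendsto_ofReal_atTop.comp h1).congr' ?_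
        filter_upwards [self_mem_nhdsWithin] with z hz
        have : z ≠ 0 := hz
        simp [hψ, this]
      rw [ContinuousAt, show ψ ε 0 = ⊤ by simp [hψ]]
      rw [← nhdsNE_sup_pure, tendsto_sup]
      refine ⟨h4, ?_⟩
      rw [tendsto_pure_left]
      intro s hs
      have : ψ ε 0 = ⊤ := by simp [hψ]
      rw [this]; exact mem_of_mem_nhds hs
    · have : ContinuousAt (fun z : ℂ => ENNReal.ofReal (φ ε ‖z‖)) z := by
        refine ENNReal.continuous_ofReal.continuousAt.comp ?_
        refine ContinuousAt.sub (by fun_prop) ?_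
        exact (continuous_norm.continuousAt).log (norm_ne_zero_iff.2 hz)
      refine this.congr ?_
      filter_upwards [isOpen_ne.mem_nhds hz] with y hy
      have : y ≠ 0 := hy
      simp [hψ, this]
  have hfin : ∀ ε, 0 < ε → 0 ≤ ε * B + M * C ε - l0 ∧
      ∫⁻ t, ψ ε (u t) ∂μ ≤ ENNReal.ofReal (ε * B + M * C ε - l0) := by
    intro ε hε
    have hlimR : Tendsto (fun n => ε * B + M * C ε - l n) atTop (𝓝 (ε * B + M * C ε - l0)) :=
      tendsto_const_nhds.sub hl0
    constructor
    · refine ge_of_tendsto' hlimR fun n => le_trans (integral_nonneg_of_ae ?_) (hφint ε hε n)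
      filter_upwards [hne n] with t ht using hφ0 ε hε _ (norm_pos_iff.2 ht)
    calc ∫⁻ t, ψ ε (u t) ∂μ
        ≤ ∫⁻ t, liminf (fun n => ψ ε (v n t)) atTop ∂μ := by
          refine lintegral_mono_ae ?_
          filter_upwards [hlim] with t ht
          have : Tendsto (fun n => ψ ε (v n t)) atTop (𝓝 (ψ ε (u t))) :=
            ((hcont ε hε).tendsto _).comp ht
          rw [this.liminf_eq]
      _ ≤ liminf (fun n => ∫⁻ t, ψ ε (v n t) ∂μ) atTop :=
          lintegral_liminf_le' fun n => (hcont ε hε).measurable.comp_aemeasurable (hm n).aemeasurable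
      _ ≤ liminf (fun n => ENNReal.ofReal (ε * B + M * C ε - l n)) atTop := by
          refine liminf_le_liminf (Eventually.of_forall fun n => ?_)
          have : ∫⁻ t, ψ ε (v n t) ∂μ = ∫⁻ t, ENNReal.ofReal (φ ε ‖v n t‖) ∂μ := by
            refine lintegral_congr_ae ?_
            filter_upwards [hne n] with t ht
            simp [hψ, ht]
          rw [this, ← ofReal_integral_eq_lintegral_ofReal (hφi ε n)
            (by filter_upwards [hne n] with t ht using hφ0 ε hε _ (norm_pos_iff.2 ht))]
          exact ENNReal.ofReal_le_ofReal (hφint ε hε n)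
      _ = _ := ((ENNReal.continuous_ofReal.tendsto _).comp hlimR).liminf_eq
  have hune : ∀ᵐ t ∂μ, u t ≠ 0 := by
    have h1 := ae_lt_top' ((hcont 1 one_pos).measurable.comp_aemeasurable hum.aemeasurable)
      (((hfin 1 one_pos).2.trans_lt ENNReal.ofReal_lt_top).ne)
    filter_upwards [h1] with t ht h
    simp [hψ, h] at ht
  have hlogm : AEStronglyMeasurable (fun t => Real.log ‖u t‖) μ :=
    (Real.measurable_log.comp_aemeasurable hum.norm.aemeasurable).aestronglyMeasurable
  have hφu : ∀ ε, 0 < ε → Integrable (fun t => φ ε ‖u t‖) μ ∧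
      ∫ t, φ ε ‖u t‖ ∂μ ≤ ε * B + M * C ε - l0 := by
    intro ε hε
    have hnn : 0 ≤ᵐ[μ] fun t => φ ε ‖u t‖ := by
      filter_upwards [hune] with t ht using hφ0 ε hε _ (norm_pos_iff.2 ht)
    have hms : AEStronglyMeasurable (fun t => φ ε ‖u t‖) μ :=
      (((hum.norm.pow 2).const_mul ε).add aestronglyMeasurable_const).sub hlogm
    have heq : ∫⁻ t, ENNReal.ofReal (φ ε ‖u t‖) ∂μ = ∫⁻ t, ψ ε (u t) ∂μ := by
      refine lintegral_congr_ae ?_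
      filter_upwards [hune] with t ht
      simp [hψ, ht]
    have hle := (hfin ε hε).2
    rw [← heq] at hle
    have hI : Integrable (fun t => φ ε ‖u t‖) μ := by
      refine ⟨hms, ?_⟩
      rw [hasFiniteIntegral_iff_ofReal hnn]
      exact hle.trans_lt ENNReal.ofReal_lt_top
    refine ⟨hI, ?_⟩
    rw [← ofReal_integral_eq_lintegral_ofReal hI hnn] at hle
    exact (ENNReal.ofReal_le_ofReal_iff (hfin ε hε).1).1 hle
  have hli' : Integrable (fun t => Real.log ‖u t‖) μ := by
    have := ((hsqu.const_mul 1).add (integrable_const (C 1))).sub (hφu 1 one_pos).1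
    refine this.congr (Eventually.of_forall fun t => ?_)
    simp [hφ]
  refine ⟨hune, hli', hsqu, ?_⟩
  have hineq : ∀ ε, 0 < ε → l0 ≤ ε * B + ∫ t, Real.log ‖u t‖ ∂μ := by
    intro ε hε
    have h := (hφu ε hε).2
    simp only [hφ] at h
    have hI : Integrable (fun t => ε * ‖u t‖ ^ 2 + C ε) μ := (hsqu.const_mul ε).add (integrable_const _)
    rw [integral_sub hI hli',
      integral_add (hsqu.const_mul ε) (integrable_const _), integral_const_mul, integral_const,
      smul_eq_mul] at h
    have h2 : 0 ≤ ε * ∫ t, ‖u t‖^2 ∂μ := mul_nonneg hε.le (integral_nonneg fun t => by positivity)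
    have h3 : μ.real Set.univ = M := rfl
    rw [h3] at h
    linarith
  have hT : Tendsto (fun ε : ℝ => ε * B + ∫ t, Real.log ‖u t‖ ∂μ) (𝓝[>] 0) (𝓝 (0 * B + ∫ t, Real.log ‖u t‖ ∂μ)) :=
    (Continuous.tendsto (by fun_prop) 0).mono_left nhdsWithin_le_nhds
  rw [zero_mul, zero_add] at hT
  refine ge_of_tendsto hT ?_
  filter_upwards [self_mem_nhdsWithin] with ε hε using hineq ε hε

theorem mC_integral (f : ℝ → ℝ) : ∫ t, f t ∂mC = ∫ t in (0:ℝ)..2 * Real.pi, f t := by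
  rw [intervalIntegral.integral_of_le Real.two_pi_pos.le, integral_Ico_eq_integral_Ioo,
    integral_Ioc_eq_integral_Ioo]

theorem jensen_closed {f : ℂ → ℂ} (hf : AnalyticOnNhd ℂ f (Metric.closedBall 0 1)) (h0 : f 0 ≠ 0) :
    (∀ᵐ θ ∂mC, f (eC θ) ≠ 0) ∧ Integrable (fun θ => Real.log ‖f (eC θ)‖) mC ∧
      2 * Real.pi * Real.log ‖f 0‖ ≤ ∫ θ, Real.log ‖f (eC θ)‖ ∂mC := by
  have hmap : ∀ θ, circleMap 0 1 θ = eC θ := fun θ => by simp [circleMap, eC]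
  have hf' : AnalyticOnNhd ℂ f (Metric.closedBall 0 |(1:ℝ)|) := by simpa using hf
  refine ⟨?_, ?_, ?_⟩
  · have h1 := hf.preimage_zero_mem_codiscreteWithin (x := 0) h0 (by simp)
      ((convex_closedBall (0:ℂ) 1).isConnected ⟨0, by simp⟩)
    have h2 : f ⁻¹' {0}ᶜ ∈ codiscreteWithin (Metric.sphere (0:ℂ) |1|) :=
      codiscreteWithin_mono (by rw [abs_one]; exact Metric.sphere_subset_closedBall) h1
    have h3 := circleMap_preimage_codiscrete (c := 0) one_ne_zero h2
    have h4 := ae_restrict_le_codiscreteWithin (μ := volume) (measurableSet_Ico (a := (0:ℝ)) (b := 2 * Real.pi))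
      (codiscreteWithin_mono (Set.subset_univ _) h3)
    filter_upwards [h4] with θ hθ
    rw [← hmap]; exact hθ
  · have h1 := hf'.meromorphicOn.mono_set (Metric.sphere_subset_closedBall) |>.circleIntegrable_log_norm
    have h2 : IntervalIntegrable (fun θ => Real.log ‖f (eC θ)‖) volume 0 (2 * Real.pi) := by
      have := h1
      simp only [CircleIntegrable, hmap] at this
      exact this
    rw [intervalIntegrable_iff_integrableOn_Ico_of_le Real.two_pi_pos.le] at h2
    exact h2
  · have h1 := hf'.circleAverage_log_norm one_ne_zero h0
    rw [Real.circleAverage] at h1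
    simp only [hmap] at h1
    rw [mC_integral]
    have h2 : 0 ≤ ∑ᶠ u, (MeromorphicOn.divisor f (Metric.closedBall 0 |(1:ℝ)|) u : ℝ) * Real.log (1 * ‖0 - u‖⁻¹) := by
      refine finsum_nonneg fun u => ?_
      by_cases hu : u ∈ Metric.closedBall (0:ℂ) |(1:ℝ)|
      · refine mul_nonneg ?_ ?_
        · have := (MeromorphicOn.AnalyticOnNhd.divisor_nonneg hf') u
          exact_mod_cast this
        · have hu' : ‖u‖ ≤ 1 := by simpa using hu
          rw [one_mul, zero_sub, norm_neg]
          by_cases h : u = 0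
          · simp [h]
          · exact Real.log_nonneg ((one_le_inv₀ (norm_pos_iff.2 h)).2 hu')
      · rw [Function.locallyFinsuppWithin.apply_eq_zero_of_notMem _ hu]; simp
    have hpi := Real.pi_pos
    rw [smul_eq_mul] at h1
    have h3 : Real.log ‖f 0‖ ≤ (2 * Real.pi)⁻¹ * ∫ θ in (0:ℝ)..2 * Real.pi, Real.log ‖f (eC θ)‖ := by
      rw [h1]; linarith
    rw [inv_mul_eq_div, le_div_iff₀ (by positivity)] at h3
    linarith

theorem jensen_bd {c : ℕ → ℂ} (hc : CMemH2 c) {w : ℂ} (hw : ‖w‖ < 1) (hF : cEval c w ≠ 0) {u : ℝ → ℂ}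
    (hu : ∀ᵐ θ ∂mC, Tendsto (fun r : ℝ => cEval c (r * tauC w (eC θ))) (𝓝[<] 1) (𝓝 (u θ))) :
    (∀ᵐ θ ∂mC, u θ ≠ 0) ∧ Integrable (fun t => Real.log ‖u t‖) mC ∧
      Integrable (fun t => ‖u t‖ ^ 2) mC ∧
      2 * Real.pi * Real.log ‖cEval c w‖ ≤ ∫ t, Real.log ‖u t‖ ∂mC := by
  obtain ⟨K, hK⟩ := tau_lintegral hw
  have han := cH_analytic hc
  -- choose the sequence
  have hcw : Tendsto (fun r : ℝ => cEval c (r * w)) (𝓝[<] 1) (𝓝 (cEval c w)) := by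
    have h1 : ContinuousAt (cEval c) w := (han w (by simpa using hw)).continuousAt
    have h2 : Tendsto (fun r : ℝ => (r:ℂ) * w) (𝓝 1) (𝓝 (((1:ℝ):ℂ) * w)) := Continuous.tendsto (by fun_prop) 1
    rw [Complex.ofReal_one, one_mul] at h2
    exact h1.tendsto.comp (h2.mono_left nhdsWithin_le_nhds)
  have hev : ∀ᶠ r : ℝ in 𝓝[<] 1, (0 < r ∧ r < 1) ∧ cEval c (r * w) ≠ 0 := by
    refine Filter.Eventually.and ?_ (hcw.eventually_ne hF)
    filter_upwards [Ioo_mem_nhdsLT (zero_lt_one' ℝ)] with r hr using hr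
  obtain ⟨ρ0, hρ0⟩ := exists_seq_tendsto (𝓝[<] (1:ℝ))
  obtain ⟨N, hN⟩ := eventually_atTop.1 (hρ0.eventually hev)
  set ρ : ℕ → ℝ := fun n => ρ0 (n + N) with hρdef
  have hρ : Tendsto ρ atTop (𝓝[<] 1) := hρ0.comp (tendsto_add_atTop_nat N)
  have hρp : ∀ n, (0 < ρ n ∧ ρ n < 1) ∧ cEval c (ρ n * w) ≠ 0 := fun n => hN _ (Nat.le_add_left _ _)
  have hball : ∀ n z, ‖z‖ ≤ 1 → (ρ n : ℂ) * z ∈ Metric.ball (0:ℂ) 1 := by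
    intro n z hz
    have := (hρp n).1
    rw [mem_ball_zero_iff, norm_mul, Complex.norm_real, Real.norm_of_nonneg this.1.le]
    nlinarith [norm_nonneg z]
  have hanF : ∀ n, AnalyticOnNhd ℂ (fun z => cEval c (ρ n * tauC w z)) (Metric.closedBall 0 1) := by
    intro n z hz
    have hz' : ‖z‖ ≤ 1 := by simpa using hz
    have h1 := han _ (hball n _ (tauC_norm_le hw hz'))
    have h2 : AnalyticAt ℂ (fun z => (ρ n : ℂ) * tauC w z) z := by
      unfold tauC
      refine analyticAt_const.mul (AnalyticAt.mul (AnalyticAt.inv ?_ (tauC_den_ne hw hz')) ?_)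
      · exact analyticAt_const.sub (analyticAt_id.mul analyticAt_const)
      · exact analyticAt_const.sub analyticAt_id
    exact AnalyticAt.comp' h1 h2
  have hJ := fun n => jensen_closed (hanF n) (by rw [tauC_zero]; exact (hρp n).2)
  have hcontv : ∀ n, Continuous fun θ => cEval c (ρ n * tauC w (eC θ)) := by
    intro n
    refine han.continuousOn.comp_continuous (continuous_const.mul (tauC_eC_cont hw)) fun θ => ?_
    exact hball n _ (tauC_norm_le hw (eC_norm θ).le)
  have hcI : ∀ g : ℝ → ℝ, Continuous g → Integrable g mC := fun g hg =>
    (hg.integrableOn_Icc (a := 0) (b := 2 * Real.pi)).mono_set Set.Ico_subset_Icc_self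
  have hfinal := log_fatou (μ := mC) (v := fun n θ => cEval c (ρ n * tauC w (eC θ))) (u := u)
    (B := K * (2 * Real.pi * ∑' n, ‖c n‖ ^ 2)) (l := fun n => 2 * Real.pi * Real.log ‖cEval c (ρ n * w)‖)
    (l0 := 2 * Real.pi * Real.log ‖cEval c w‖)
    (fun n => (hcontv n).aestronglyMeasurable) ?_ (fun n => (hJ n).1) (fun n => (hJ n).2.1)
    (fun n => hcI _ (by have := hcontv n; fun_prop)) ?_ (fun n => by
      have := (hJ n).2.2
      rw [tauC_zero] at this
      exact this) ?_
  · exact hfinal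
  · filter_upwards [hu] with θ hθ using hθ.comp hρ
  · intro n
    have hS : 0 ≤ ∑' n, ‖c n‖ ^ 2 := tsum_nonneg fun n => by positivity
    have hpi := Real.pi_pos
    set h : ℂ → ℝ≥0∞ := (Metric.closedBall (0:ℂ) 1).piecewise
      (fun z => ENNReal.ofReal (‖cEval c (ρ n * z)‖ ^ 2)) (fun _ => 0) with hh
    have hmeas : Measurable h := by
      refine ContinuousOn.measurable_piecewise ?_ continuousOn_const Metric.isClosed_closedBall.measurableSet
      refine ENNReal.continuous_ofReal.comp_continuousOn ?_
      refine ContinuousOn.pow (ContinuousOn.norm ?_) 2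
      exact han.continuousOn.comp (by fun_prop) fun z hz => hball n z (by simpa using hz)
    have hval : ∀ z, ‖z‖ = 1 → h z = ENNReal.ofReal (‖cEval c (ρ n * z)‖ ^ 2) := fun z hz => by
      rw [hh, Set.piecewise_eq_of_mem _ _ _ (by simp [hz])]
    have h1 := hK h hmeas
    have e1 : ∫⁻ θ, h (tauC w (eC θ)) ∂mC = ENNReal.ofReal (∫ θ, ‖cEval c (ρ n * tauC w (eC θ))‖ ^ 2 ∂mC) := by
      rw [ofReal_integral_eq_lintegral_ofReal (hcI _ (by have := hcontv n; fun_prop)) (Eventually.of_forall fun t => by positivity)]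
      exact lintegral_congr fun θ => hval _ (tauC_norm_eq hw (eC_norm θ))
    have hcc : Continuous fun t : ℝ => cEval c (ρ n * eC t) := cH_cont_circ hc (hρp n).1.1.le (hρp n).1.2
    have e2 : ∫⁻ θ, h (eC θ) ∂mC = ENNReal.ofReal (∫ θ, ‖cEval c (ρ n * eC θ)‖ ^ 2 ∂mC) := by
      rw [ofReal_integral_eq_lintegral_ofReal (hcI _ (by fun_prop)) (Eventually.of_forall fun t => by positivity)]
      exact lintegral_congr fun θ => hval _ (eC_norm θ)
    have e3 : ∫ θ, ‖cEval c (ρ n * eC θ)‖ ^ 2 ∂mC ≤ 2 * Real.pi * ∑' n, ‖c n‖ ^ 2 := by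
      rw [mC_integral]
      exact cH_L2_bound hc (hρp n).1.1.le (hρp n).1.2
    rw [e1, e2, ← ENNReal.ofReal_coe_nnreal, ← ENNReal.ofReal_mul (by positivity)] at h1
    have h2 := (ENNReal.ofReal_le_ofReal_iff (mul_nonneg K.2 (integral_nonneg fun t => by positivity))).1 h1
    refine h2.trans ?_
    exact mul_le_mul_of_nonneg_left e3 K.2
  · refine Tendsto.const_mul _ ?_
    exact ((hcw.comp hρ).norm).log (norm_ne_zero_iff.2 hF)

theorem q1_re : (1 : Quaternion ℝ).re = 1 := rfl
theorem q1_i : (1 : Quaternion ℝ).imI = 0 := rfl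
theorem q1_j : (1 : Quaternion ℝ).imJ = 0 := rfl
theorem q1_k : (1 : Quaternion ℝ).imK = 0 := rfl

theorem us_re {I : Quaternion ℝ} (hI : I ∈ USphere) : I.re = 0 ∧ I.imI ^ 2 + I.imJ ^ 2 + I.imK ^ 2 = 1 := by
  have h : I * I = -1 := by rw [← pow_two]; exact hI
  have h0 := congrArg QuaternionAlgebra.re h
  have h1 := congrArg QuaternionAlgebra.imI h
  have h2 := congrArg QuaternionAlgebra.imJ h
  have h3 := congrArg QuaternionAlgebra.imK h
  simp [q1_re, q1_i, q1_j, q1_k] at h0 h1 h2 h3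
  have : I.re = 0 := by
    by_contra hne
    have e1 : I.imI = 0 := by
      have : I.re * I.imI = 0 := by linarith
      simpa [hne] using this
    have e2 : I.imJ = 0 := by
      have : I.re * I.imJ = 0 := by linarith
      simpa [hne] using this
    have e3 : I.imK = 0 := by
      have : I.re * I.imK = 0 := by linarith
      simpa [hne] using this
    rw [e1, e2, e3] at h0
    nlinarith [sq_nonneg I.re]
  refine ⟨this, ?_⟩
  rw [this] at h0
  linarith

theorem us_of {I : Quaternion ℝ} (h0 : I.re = 0) (h1 : I.imI ^ 2 + I.imJ ^ 2 + I.imK ^ 2 = 1) : I ∈ USphere := by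
  show I ^ 2 = -1
  rw [pow_two]
  ext <;> simp [h0, q1_re, q1_i, q1_j, q1_k]
  · linarith
  · ring
  · ring
  · ring

/-- embedding of the complex plane as the slice through `I` -/
noncomputable def iotaQ (I : Quaternion ℝ) (z : ℂ) : Quaternion ℝ := (z.re : Quaternion ℝ) + z.im • I

theorem qnorm_sq (q : Quaternion ℝ) : ‖q‖ ^ 2 = q.re ^ 2 + q.imI ^ 2 + q.imJ ^ 2 + q.imK ^ 2 := by
  rw [← Quaternion.normSq_def', Quaternion.normSq_eq_norm_mul_self, pow_two]

theorem iota_one (I : Quaternion ℝ) : iotaQ I 1 = 1 := by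
  simp [iotaQ]

theorem iota_mul {I : Quaternion ℝ} (hI : I ∈ USphere) (z w : ℂ) : iotaQ I (z * w) = iotaQ I z * iotaQ I w := by
  obtain ⟨h0, h1⟩ := us_re hI
  unfold iotaQ
  ext <;> simp [h0]
  · linear_combination (z.im * w.im) * h1
  · ring
  · ring
  · ring

theorem iota_sub (I : Quaternion ℝ) (z w : ℂ) : iotaQ I (z - w) = iotaQ I z - iotaQ I w := by
  unfold iotaQ
  ext <;> simp <;> ring

theorem iota_norm {I : Quaternion ℝ} (hI : I ∈ USphere) (z : ℂ) : ‖iotaQ I z‖ = ‖z‖ := by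
  obtain ⟨h0, h1⟩ := us_re hI
  rw [← sq_eq_sq₀ (norm_nonneg _) (norm_nonneg _), qnorm_sq, Complex.sq_norm, Complex.normSq_apply]
  simp [iotaQ, h0]
  linear_combination (z.im ^ 2) * h1

theorem iota_star {I : Quaternion ℝ} (hI : I ∈ USphere) (z : ℂ) : star (iotaQ I z) = iotaQ I (starRingEnd ℂ z) := by
  obtain ⟨h0, h1⟩ := us_re hI
  unfold iotaQ
  ext <;> simp [h0]

theorem iota_pow {I : Quaternion ℝ} (hI : I ∈ USphere) (z : ℂ) (n : ℕ) : iotaQ I (z ^ n) = iotaQ I z ^ n := by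
  induction n with
  | zero => simp [iota_one]
  | succ n ih => rw [pow_succ, pow_succ, iota_mul hI, ih]

theorem iota_inv {I : Quaternion ℝ} (hI : I ∈ USphere) (z : ℂ) : iotaQ I z⁻¹ = (iotaQ I z)⁻¹ := by
  by_cases hz : z = 0
  · subst hz; simp [iotaQ]
  · refine eq_inv_of_mul_eq_one_left ?_
    rw [← iota_mul hI, inv_mul_cancel₀ hz, iota_one]

theorem iota_ofReal (I : Quaternion ℝ) (r : ℝ) : iotaQ I (r : ℂ) = (r : Quaternion ℝ) := by
  simp [iotaQ]

theorem iota_cont (I : Quaternion ℝ) : Continuous (iotaQ I) := by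
  unfold iotaQ
  exact (Quaternion.continuous_coe.comp Complex.continuous_re).add (Complex.continuous_im.smul continuous_const)

theorem iota_eC (I : Quaternion ℝ) (t : ℝ) : iotaQ I (eC t) = ptOn I t := by
  simp [iotaQ, ptOn, eC, Complex.exp_ofReal_mul_I_re, Complex.exp_ofReal_mul_I_im]

theorem iota_tau {I : Quaternion ℝ} (hI : I ∈ USphere) (w : ℂ) (θ : ℝ) :
    (1 - ptOn I θ * star (iotaQ I w))⁻¹ * (iotaQ I w - ptOn I θ) = iotaQ I (tauC w (eC θ)) := by
  unfold tauC
  rw [iota_mul hI, iota_inv hI, iota_sub, iota_sub, iota_mul hI, iota_one, iota_eC, iota_star hI]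

/-- complex coordinate in the slice through `I` -/
noncomputable def piQ (I : Quaternion ℝ) : Quaternion ℝ →L[ℝ] ℂ :=
  LinearMap.toContinuousLinearMap
    { toFun := fun q => ⟨q.re, -(I * q).re⟩
      map_add' := fun x y => by
        apply Complex.ext <;> simp; ring
      map_smul' := fun r x => by
        apply Complex.ext <;> simp; ring }

theorem piQ_apply (I q : Quaternion ℝ) : piQ I q = ⟨q.re, -(I * q).re⟩ := rfl

theorem piQ_iota {I : Quaternion ℝ} (hI : I ∈ USphere) (z : ℂ) (q : Quaternion ℝ) :
    piQ I (iotaQ I z * q) = z * piQ I q := by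
  obtain ⟨h0, h1⟩ := us_re hI
  rw [piQ_apply, piQ_apply]
  apply Complex.ext <;> simp [iotaQ, h0]
  · ring
  · linear_combination (z.im * q.re) * h1

theorem piQ_norm_le {I : Quaternion ℝ} (hI : I ∈ USphere) (q : Quaternion ℝ) : ‖piQ I q‖ ≤ ‖q‖ := by
  obtain ⟨h0, h1⟩ := us_re hI
  rw [← sq_le_sq₀ (norm_nonneg _) (norm_nonneg _), qnorm_sq, Complex.sq_norm, Complex.normSq_apply, piQ_apply]
  simp [h0]
  have := sq_nonneg (I.imI * q.imJ - I.imJ * q.imI)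
  have := sq_nonneg (I.imI * q.imK - I.imK * q.imI)
  have := sq_nonneg (I.imK * q.imJ - I.imJ * q.imK)
  have e : q.imI ^ 2 + q.imJ ^ 2 + q.imK ^ 2 = (I.imI ^ 2 + I.imJ ^ 2 + I.imK ^ 2) * (q.imI ^ 2 + q.imJ ^ 2 + q.imK ^ 2) := by
    rw [h1, one_mul]
  nlinarith

/-- coefficients of slice component -/
noncomputable def cofQ (I u : Quaternion ℝ) (a : ℕ → Quaternion ℝ) : ℕ → ℂ := fun n => piQ I (a n * u)

theorem cof_mem {I : Quaternion ℝ} (hI : I ∈ USphere) (u : Quaternion ℝ) {a : ℕ → Quaternion ℝ} (ha : MemH2 a) :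
    CMemH2 (cofQ I u a) := by
  refine Summable.of_nonneg_of_le (fun n => by positivity) (fun n => ?_) (Summable.mul_right (‖u‖ ^ 2) ha)
  rw [← mul_pow, ← norm_mul]
  exact pow_le_pow_left₀ (norm_nonneg _) (piQ_norm_le hI _) 2

theorem memH2_bdd {a : ℕ → Quaternion ℝ} (ha : MemH2 a) : ∃ C, ∀ n, ‖a n‖ ≤ C := by
  refine ⟨1 + ∑' n, ‖a n‖ ^ 2, fun n => ?_⟩
  have := ha.le_tsum n (fun j _ => by positivity)
  nlinarith [sq_nonneg (‖a n‖ - 1)]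

theorem evalS_summable {a : ℕ → Quaternion ℝ} (ha : MemH2 a) {q : Quaternion ℝ} (hq : ‖q‖ < 1) :
    Summable fun n => q ^ n * a n := by
  obtain ⟨C, hC⟩ := memH2_bdd ha
  refine Summable.of_norm_bounded (g := fun n => ‖q‖ ^ n * C) ((summable_geometric_of_lt_one (norm_nonneg _) hq).mul_right C) fun n => ?_
  rw [norm_mul, norm_pow]
  exact mul_le_mul_of_nonneg_left (hC n) (by positivity)

theorem evalS_cont {a : ℕ → Quaternion ℝ} (ha : MemH2 a) : ContinuousOn (evalS a) (Metric.ball 0 1) := by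
  obtain ⟨C, hC⟩ := memH2_bdd ha
  intro q hq
  rw [mem_ball_zero_iff] at hq
  obtain ⟨r, h1, h2⟩ := exists_between hq
  have hr : 0 ≤ r := (norm_nonneg _).trans h1.le
  have : ContinuousOn (evalS a) (Metric.ball 0 r) := by
    refine continuousOn_tsum (u := fun n => r ^ n * C) (fun n => by fun_prop) ((summable_geometric_of_lt_one hr h2).mul_right C) fun n x hx => ?_
    rw [mem_ball_zero_iff] at hx
    rw [norm_mul, norm_pow]
    have := (norm_nonneg _).trans (hC n)
    gcongr
    exact hC n
  exact (this.continuousAt (Metric.isOpen_ball.mem_nhds (by simpa using h1))).continuousWithinAt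

theorem cof_eval {I : Quaternion ℝ} (hI : I ∈ USphere) (u : Quaternion ℝ) {a : ℕ → Quaternion ℝ} (ha : MemH2 a)
    {z : ℂ} (hz : ‖z‖ < 1) : cEval (cofQ I u a) z = piQ I (evalS a (iotaQ I z) * u) := by
  have hs := evalS_summable ha (q := iotaQ I z) (by rwa [iota_norm hI])
  unfold cEval evalS cofQ
  rw [← hs.tsum_mul_right, ContinuousLinearMap.map_tsum _ (hs.mul_right u)]
  refine tsum_congr fun n => ?_
  rw [← iota_pow hI, mul_assoc, piQ_iota hI]

/-- quaternion from coordinates -/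
def mkQ (a b c d : ℝ) : Quaternion ℝ := ⟨a, b, c, d⟩
theorem mkQ_re (a b c d : ℝ) : (mkQ a b c d).re = a := rfl
theorem mkQ_i (a b c d : ℝ) : (mkQ a b c d).imI = b := rfl
theorem mkQ_j (a b c d : ℝ) : (mkQ a b c d).imJ = c := rfl
theorem mkQ_k (a b c d : ℝ) : (mkQ a b c d).imK = d := rfl

theorem bdval_eq {a : ℕ → Quaternion ℝ} {q L : Quaternion ℝ}
    (h : Tendsto (fun r : ℝ => evalS a ((r : Quaternion ℝ) * q)) (𝓝[<] (1 : ℝ)) (𝓝 L)) : bdval a q = L := by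
  have hex : ∃ L, Tendsto (fun r : ℝ => evalS a ((r : Quaternion ℝ) * q)) (𝓝[<] (1 : ℝ)) (𝓝 L) := ⟨L, h⟩
  unfold bdval
  rw [dif_pos hex]
  exact tendsto_nhds_unique hex.choose_spec h

theorem r_ev : ∀ᶠ r : ℝ in 𝓝[<] (1 : ℝ), 0 ≤ r ∧ r < 1 := by
  have h1 : ∀ᶠ r : ℝ in 𝓝[<] (1 : ℝ), 0 ≤ r :=
    mem_nhdsWithin_of_mem_nhds (Ici_mem_nhds zero_lt_one)
  filter_upwards [h1, self_mem_nhdsWithin] with r h hr using ⟨h, hr⟩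

theorem iota_real_mul {I : Quaternion ℝ} (hI : I ∈ USphere) (r : ℝ) (z : ℂ) :
    (r : Quaternion ℝ) * iotaQ I z = iotaQ I (r * z) := by
  rw [iota_mul hI, iota_ofReal]

theorem rz_lt {r : ℝ} {z : ℂ} (hr : 0 ≤ r ∧ r < 1) (hz : ‖z‖ = 1) : ‖(r : ℂ) * z‖ < 1 := by
  rw [norm_mul, hz, mul_one, Complex.norm_real, Real.norm_eq_abs, abs_of_nonneg hr.1]
  exact hr.2

theorem q_decomp (I q : Quaternion ℝ) : q = ((piQ I (q * 1)).re : Quaternion ℝ)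
    - (piQ I (q * (mkQ 0 1 0 0))).re • (mkQ 0 1 0 0)
    - (piQ I (q * (mkQ 0 0 1 0))).re • (mkQ 0 0 1 0)
    - (piQ I (q * (mkQ 0 0 0 1))).re • (mkQ 0 0 0 1) := by
  ext <;> simp [piQ_apply, mkQ_re, mkQ_i, mkQ_j, mkQ_k]

theorem slice_radial {a : ℕ → Quaternion ℝ} (ha : MemH2 a) {I : Quaternion ℝ} (hI : I ∈ USphere) :
    ∀ᵐ t ∂mC, Tendsto (fun r : ℝ => evalS a ((r : Quaternion ℝ) * iotaQ I (eC t))) (𝓝[<] (1 : ℝ))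
      (𝓝 (bdval a (iotaQ I (eC t)))) := by
  filter_upwards [fatou_radial (cof_mem hI 1 ha), fatou_radial (cof_mem hI (mkQ 0 1 0 0) ha),
    fatou_radial (cof_mem hI (mkQ 0 0 1 0) ha), fatou_radial (cof_mem hI (mkQ 0 0 0 1) ha)] with t h1 h2 h3 h4
  have key : ∀ u, (∃ L : ℂ, Tendsto (fun r : ℝ => cEval (cofQ I u a) (r * Complex.exp (t * Complex.I))) (𝓝[<] 1) (𝓝 L)) →
      ∃ L : ℂ, Tendsto (fun r : ℝ => piQ I (evalS a ((r : Quaternion ℝ) * iotaQ I (eC t)) * u)) (𝓝[<] 1) (𝓝 L) := by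
    rintro u ⟨L, hL⟩
    refine ⟨L, hL.congr' ?_⟩
    filter_upwards [r_ev] with r hr
    rw [iota_real_mul hI]
    exact cof_eval hI u ha (rz_lt hr (eC_norm t))
  obtain ⟨L1, h1⟩ := key _ h1
  obtain ⟨L2, h2⟩ := key _ h2
  obtain ⟨L3, h3⟩ := key _ h3
  obtain ⟨L4, h4⟩ := key _ h4
  have hre : ∀ {g : ℝ → ℂ} {L : ℂ}, Tendsto g (𝓝[<] 1) (𝓝 L) → Tendsto (fun r => (g r).re) (𝓝[<] 1) (𝓝 L.re) :=
    fun h => (Complex.continuous_re.tendsto _).comp h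
  have := ((((Quaternion.continuous_coe.tendsto _).comp (hre h1)).sub
    ((hre h2).smul_const (mkQ 0 1 0 0))).sub ((hre h3).smul_const (mkQ 0 0 1 0))).sub
    ((hre h4).smul_const (mkQ 0 0 0 1))
  have h5 := this.congr (f₂ := fun r : ℝ => evalS a ((r : Quaternion ℝ) * iotaQ I (eC t))) fun r => (q_decomp I _).symm
  rw [bdval_eq h5]
  exact h5

theorem q_sq_bd (I q : Quaternion ℝ) : ‖q‖ ^ 2 ≤ 8 * (‖piQ I (q * 1)‖ ^ 2 + ‖piQ I (q * (mkQ 1 1 0 0))‖ ^ 2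
    + ‖piQ I (q * (mkQ 1 0 1 0))‖ ^ 2 + ‖piQ I (q * (mkQ 1 0 0 1))‖ ^ 2) := by
  have key : ∀ u, (q * u).re ^ 2 ≤ ‖piQ I (q * u)‖ ^ 2 := fun u => by
    rw [Complex.sq_norm, Complex.normSq_apply, piQ_apply]
    nlinarith [sq_nonneg (-(I * (q * u)).re)]
  have h1 := key 1
  have h2 := key (mkQ 1 1 0 0)
  have h3 := key (mkQ 1 0 1 0)
  have h4 := key (mkQ 1 0 0 1)
  rw [qnorm_sq]
  have e1 : (q * 1).re = q.re := by simp
  have e2 : (q * (mkQ 1 1 0 0)).re = q.re - q.imI := by simp [mkQ_re, mkQ_i, mkQ_j, mkQ_k]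
  have e3 : (q * (mkQ 1 0 1 0)).re = q.re - q.imJ := by simp [mkQ_re, mkQ_i, mkQ_j, mkQ_k]
  have e4 : (q * (mkQ 1 0 0 1)).re = q.re - q.imK := by simp [mkQ_re, mkQ_i, mkQ_j, mkQ_k]
  rw [e1] at h1
  rw [e2] at h2
  rw [e3] at h3
  rw [e4] at h4
  nlinarith [sq_nonneg (2 * q.re - q.imI), sq_nonneg (2 * q.re - q.imJ), sq_nonneg (2 * q.re - q.imK)]

theorem slice_jensen {a : ℕ → Quaternion ℝ} (ha : MemH2 a) {I : Quaternion ℝ} (hI : I ∈ USphere) {w : ℂ}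
    (hw : ‖w‖ < 1) (hF : evalS a (iotaQ I w) ≠ 0) :
    (∀ᵐ θ ∂mC, bdval a (iotaQ I (tauC w (eC θ))) ≠ 0) ∧
    2 * Real.pi * Real.log ‖evalS a (iotaQ I w)‖ ≤ ∫ θ, Real.log ‖bdval a (iotaQ I (tauC w (eC θ)))‖ ∂mC := by
  set A := evalS a (iotaQ I w) with hA
  set B : ℝ → Quaternion ℝ := fun θ => bdval a (iotaQ I (tauC w (eC θ))) with hB
  have hA0 : ‖A‖ ≠ 0 := norm_ne_zero_iff.2 hF
  set u0 : Quaternion ℝ := (‖A‖ : Quaternion ℝ) * A⁻¹ with hu0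
  have hu0n : ‖u0‖ = 1 := by
    rw [hu0, norm_mul, norm_inv, Quaternion.norm_coe, norm_norm, mul_inv_cancel₀ hA0]
  have hAu : A * u0 = (‖A‖ : Quaternion ℝ) := by
    rw [hu0, Quaternion.coe_commutes, ← mul_assoc, mul_inv_cancel₀ hF, one_mul]
  -- radial limits along the Moebius images
  have hlim : ∀ᵐ θ ∂mC, Tendsto (fun r : ℝ => evalS a ((r : Quaternion ℝ) * iotaQ I (tauC w (eC θ)))) (𝓝[<] (1 : ℝ))
      (𝓝 (B θ)) := by
    exact tau_ae (P := fun z => Tendsto (fun r : ℝ => evalS a ((r : Quaternion ℝ) * iotaQ I z)) (𝓝[<] (1 : ℝ))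
      (𝓝 (bdval a (iotaQ I z)))) hw (slice_radial ha hI)
  have hJ : ∀ e : Quaternion ℝ, e.re = 1 → 
      (∀ᵐ θ ∂mC, piQ I (B θ * u0 * e) ≠ 0) ∧ Integrable (fun θ => Real.log ‖piQ I (B θ * u0 * e)‖) mC ∧
      Integrable (fun θ => ‖piQ I (B θ * u0 * e)‖ ^ 2) mC ∧
      2 * Real.pi * Real.log ‖cEval (cofQ I (u0 * e) a) w‖ ≤ ∫ θ, Real.log ‖piQ I (B θ * u0 * e)‖ ∂mC := by
    intro e he
    refine jensen_bd (cof_mem hI (u0 * e) ha) hw ?_ ?_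
    · rw [cof_eval hI _ ha hw, ← hA, ← mul_assoc, hAu]
      intro h
      have := congrArg Complex.re h
      rw [piQ_apply] at this
      simp [he, hF] at this
    · filter_upwards [hlim] with θ hθ
      have h1 : Tendsto (fun r : ℝ => piQ I (evalS a ((r : Quaternion ℝ) * iotaQ I (tauC w (eC θ))) * u0 * e)) (𝓝[<] (1 : ℝ))
        (𝓝 (piQ I (B θ * u0 * e))) := ((piQ I).continuous.tendsto _).comp ((hθ.mul_const u0).mul_const e)
      refine h1.congr' ?_
      filter_upwards [r_ev] with r hr
      rw [cof_eval hI _ ha (rz_lt hr (tauC_norm_eq hw (eC_norm θ))), iota_real_mul hI, mul_assoc]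
  obtain ⟨j1, j2, j3, j4⟩ := hJ 1 rfl
  obtain ⟨-, -, k3, -⟩ := hJ (mkQ 1 1 0 0) rfl
  obtain ⟨-, -, l3, -⟩ := hJ (mkQ 1 0 1 0) rfl
  obtain ⟨-, -, m3, -⟩ := hJ (mkQ 1 0 0 1) rfl
  have hBn : ∀ θ, ‖B θ * u0‖ = ‖B θ‖ := fun θ => by rw [norm_mul, hu0n, mul_one]
  have hle : ∀ θ, ‖piQ I (B θ * u0 * 1)‖ ≤ ‖B θ‖ := fun θ => by
    rw [← hBn θ]
    simpa using piQ_norm_le hI (B θ * u0)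
  have hBmeas : AEStronglyMeasurable B mC := by
    obtain ⟨ρ, hρ1, hρ2, hρ3⟩ := exists_seq_strictMono_tendsto (1 : ℝ)
    have hρ : Tendsto (fun n => max 0 (ρ n)) atTop (𝓝[<] (1 : ℝ)) := by
      refine tendsto_nhdsWithin_iff.2 ⟨?_, Eventually.of_forall fun n => max_lt zero_lt_one (hρ2 n)⟩
      have := (tendsto_const_nhds (x := (0 : ℝ))).max hρ3
      simpa using this
    refine aestronglyMeasurable_of_tendsto_ae atTop
      (f := fun (n : ℕ) θ => evalS a (((max 0 (ρ n) : ℝ) : Quaternion ℝ) * iotaQ I (tauC w (eC θ)))) (fun n => ?_) ?_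
    · refine Continuous.aestronglyMeasurable ?_
      refine (evalS_cont ha).comp_continuous (continuous_const.mul ((iota_cont I).comp (tauC_eC_cont hw))) fun θ => ?_
      rw [mem_ball_zero_iff, iota_real_mul hI, iota_norm hI]
      exact rz_lt ⟨le_max_left _ _, max_lt zero_lt_one (hρ2 n)⟩ (tauC_norm_eq hw (eC_norm θ))
    · filter_upwards [hlim] with θ hθ
      exact hθ.comp hρ
  have hne : ∀ᵐ θ ∂mC, B θ ≠ 0 := by
    filter_upwards [j1] with θ h h0
    exact h (by simp [h0])
  have hsq : Integrable (fun θ => ‖B θ‖ ^ 2) mC := by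
    refine Integrable.mono' ((((j3.add k3).add l3).add m3).const_mul 8) (hBmeas.norm.pow 2) (Eventually.of_forall fun θ => ?_)
    rw [Real.norm_of_nonneg (by positivity), ← hBn θ]
    exact q_sq_bd I (B θ * u0)
  have hint : Integrable (fun θ => Real.log ‖B θ‖) mC := by
    refine Integrable.mono' (j2.norm.add hsq) ?_ ?_
    · exact (Real.measurable_log.comp_aemeasurable hBmeas.norm.aemeasurable).aestronglyMeasurable
    · filter_upwards [j1, hne] with θ h1 h2
      have p1 : 0 < ‖piQ I (B θ * u0 * 1)‖ := norm_pos_iff.2 h1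
      have p2 : 0 < ‖B θ‖ := norm_pos_iff.2 h2
      have l1 := Real.log_le_log p1 (hle θ)
      have l2 := Real.log_le_sub_one_of_pos p2
      have l3 : ‖B θ‖ - 1 ≤ ‖B θ‖ ^ 2 := by nlinarith [sq_nonneg (‖B θ‖ - 1)]
      show _ ≤ ‖Real.log ‖piQ I (B θ * u0 * 1)‖‖ + ‖B θ‖ ^ 2
      rw [Real.norm_eq_abs, Real.norm_eq_abs, abs_le]
      have := neg_abs_le (Real.log ‖piQ I (B θ * u0 * 1)‖)
      have := abs_nonneg (Real.log ‖piQ I (B θ * u0 * 1)‖)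
      constructor
      · nlinarith [sq_nonneg ‖B θ‖]
      · linarith
  refine ⟨hne, ?_⟩
  have e : ‖cEval (cofQ I (u0 * 1) a) w‖ = ‖A‖ := by
    rw [cof_eval hI _ ha hw, mul_one, ← hA, hAu, ← mul_one (‖A‖ : Quaternion ℝ), ← iota_ofReal I, piQ_iota hI]
    have : piQ I 1 = 1 := by
      obtain ⟨h0, h1⟩ := us_re hI
      rw [piQ_apply]
      apply Complex.ext <;> simp [h0, q1_re]
    rw [this]
    simp
  rw [e] at j4
  refine j4.trans (integral_mono_ae j2 hint ?_)
  filter_upwards [j1] with θ h1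
  exact Real.log_le_log (norm_pos_iff.2 h1) (hle θ)

theorem mkQ_eq (a b c d : ℝ) : mkQ a b c d = a • mkQ 1 0 0 0 + b • mkQ 0 1 0 0 + c • mkQ 0 0 1 0 + d • mkQ 0 0 0 1 := by
  ext <;> simp [mkQ_re, mkQ_i, mkQ_j, mkQ_k]

theorem mkQ_cont {X : Type*} [TopologicalSpace X] {a b c d : X → ℝ} (ha : Continuous a) (hb : Continuous b)
    (hc : Continuous c) (hd : Continuous d) : Continuous fun x => mkQ (a x) (b x) (c x) (d x) := by
  have : (fun x => mkQ (a x) (b x) (c x) (d x)) = fun x => a x • mkQ 1 0 0 0 + b x • mkQ 0 1 0 0 + c x • mkQ 0 0 1 0 + d x • mkQ 0 0 0 1 :=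
    funext fun x => mkQ_eq _ _ _ _
  rw [this]
  fun_prop

theorem hm2 : (μH[2] : Measure (Fin 2 → ℝ)) = volume := by
  have := hausdorffMeasure_pi_real (ι := Fin 2)
  simpa using this

theorem mkQ_sub (a b c d a' b' c' d' : ℝ) : mkQ a b c d - mkQ a' b' c' d' = mkQ (a - a') (b - b') (c - c') (d - d') := by
  ext <;> simp [mkQ_re, mkQ_i, mkQ_j, mkQ_k]

theorem mkQ_norm (a b c d : ℝ) : ‖mkQ a b c d‖ ^ 2 = a ^ 2 + b ^ 2 + c ^ 2 + d ^ 2 := qnorm_sq _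

theorem us_finite : (μH[2] : Measure (Quaternion ℝ)) USphere < ⊤ := by
  set Φ : (Fin 2 → ℝ) → Quaternion ℝ := fun v =>
    mkQ 0 (Real.cos (v 0)) (Real.sin (v 0) * Real.cos (v 1)) (Real.sin (v 0) * Real.sin (v 1)) with hΦ
  have hs : ∀ x y : ℝ, |Real.sin x - Real.sin y| ≤ |x - y| := fun x y => by
    simpa [Real.dist_eq] using Real.lipschitzWith_sin.dist_le_mul x y
  have hc : ∀ x y : ℝ, |Real.cos x - Real.cos y| ≤ |x - y| := fun x y => by
    simpa [Real.dist_eq] using Real.lipschitzWith_cos.dist_le_mul x y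
  have hL : LipschitzWith 3 Φ := by
    refine LipschitzWith.of_dist_le_mul fun v v' => ?_
    have d0 : |v 0 - v' 0| ≤ dist v v' := by rw [← Real.dist_eq]; exact dist_le_pi_dist v v' 0
    have d1 : |v 1 - v' 1| ≤ dist v v' := by rw [← Real.dist_eq]; exact dist_le_pi_dist v v' 1
    set D := dist v v'
    have hD : 0 ≤ D := dist_nonneg
    have prod : ∀ f : ℝ → ℝ, (∀ x, |f x| ≤ 1) → (∀ x y, |f x - f y| ≤ |x - y|) →
        |Real.sin (v 0) * f (v 1) - Real.sin (v' 0) * f (v' 1)| ≤ 2 * D := by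
      intro f h1 h2
      have e : Real.sin (v 0) * f (v 1) - Real.sin (v' 0) * f (v' 1) =
        (Real.sin (v 0) - Real.sin (v' 0)) * f (v 1) + Real.sin (v' 0) * (f (v 1) - f (v' 1)) := by ring
      rw [e]
      refine (abs_add_le _ _).trans ?_
      rw [abs_mul, abs_mul]
      have a1 := mul_le_mul ((hs (v 0) (v' 0)).trans d0) (h1 (v 1)) (abs_nonneg _) hD
      have a2 := mul_le_mul (Real.abs_sin_le_one (v' 0)) ((h2 (v 1) (v' 1)).trans d1) (abs_nonneg _) zero_le_one
      linarith
    have p1 := prod Real.cos Real.abs_cos_le_one hc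
    have p2 := prod Real.sin Real.abs_sin_le_one hs
    have p0 := (hc (v 0) (v' 0)).trans d0
    rw [dist_eq_norm, hΦ, mkQ_sub]
    have : (0 : ℝ) ≤ (3 : NNReal) * D := by positivity
    rw [← sq_le_sq₀ (norm_nonneg _) this, mkQ_norm]
    have s0 := sq_le_sq' (abs_le.1 p0).1 (abs_le.1 p0).2
    have s1 := sq_le_sq' (abs_le.1 p1).1 (abs_le.1 p1).2
    have s2 := sq_le_sq' (abs_le.1 p2).1 (abs_le.1 p2).2
    have : ((3 : NNReal) : ℝ) = 3 := rfl
    rw [this]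
    nlinarith
  have hsub : USphere ⊆ Φ '' Set.Icc (fun _ => -4) (fun _ => 4) := by
    intro I hI
    obtain ⟨h0, h1⟩ := us_re hI
    set z : ℂ := ⟨I.imJ, I.imK⟩
    have hz : ‖z‖ = Real.sqrt (1 - I.imI ^ 2) := by
      rw [Complex.norm_def, Complex.normSq_apply]
      congr 1
      show I.imJ * I.imJ + I.imK * I.imK = _
      linarith
    have b1 : -1 ≤ I.imI := by nlinarith [sq_nonneg I.imJ, sq_nonneg I.imK]
    have b2 : I.imI ≤ 1 := by nlinarith [sq_nonneg I.imJ, sq_nonneg I.imK]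
    have pi4 := Real.pi_le_four
    refine ⟨![Real.arccos I.imI, Complex.arg z], ⟨?_, ?_⟩, ?_⟩
    · intro i
      fin_cases i
      · have := Real.arccos_nonneg I.imI
        simp; linarith
      · have := Complex.neg_pi_lt_arg z
        simp; linarith
    · intro i
      fin_cases i
      · have := Real.arccos_le_pi I.imI
        simp; linarith
      · have := Complex.arg_le_pi z
        simp; linarith
    · have e1 : ‖z‖ * Real.cos z.arg = I.imJ := Complex.norm_mul_cos_arg z
      have e2 : ‖z‖ * Real.sin z.arg = I.imK := Complex.norm_mul_sin_arg z
      have e3 : Real.sin (Real.arccos I.imI) = ‖z‖ := by rw [Real.sin_arccos, hz]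
      rw [hΦ]
      simp only [Matrix.cons_val_zero, Matrix.cons_val_one]
      rw [e3, e1, e2, Real.cos_arccos b1 b2]
      ext <;> simp [mkQ_re, mkQ_i, mkQ_j, mkQ_k, h0]
  refine (measure_mono hsub).trans_lt ?_
  have h := (hL.lipschitzOnWith (s := Set.Icc (fun _ => -4) (fun _ => 4))).hausdorffMeasure_image_le (d := 2) zero_le_two
  refine h.trans_lt ?_
  rw [hm2]
  refine ENNReal.mul_lt_top ?_ isCompact_Icc.measure_lt_top
  exact ENNReal.rpow_lt_top_of_nonneg zero_le_two (by simp)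

theorem us_pos_aux (x y z : Quaternion ℝ → ℝ) (mk : ℝ → ℝ → ℝ → Quaternion ℝ)
    (hy : ∀ p q, |y p - y q| ≤ ‖p - q‖) (hz : ∀ p q, |z p - z q| ≤ ‖p - q‖)
    (hmk : Continuous fun v : ℝ × ℝ × ℝ => mk v.1 v.2.1 v.2.2)
    (h1 : ∀ q ∈ USphere, mk (x q) (y q) (z q) = q) (h2 : ∀ q ∈ USphere, x q ^ 2 + y q ^ 2 + z q ^ 2 = 1)
    (h3 : ∀ r s t : ℝ, r ^ 2 + s ^ 2 + t ^ 2 = 1 → mk r s t ∈ USphere)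
    (h4 : ∀ r s t, y (mk r s t) = s) (h5 : ∀ r s t, z (mk r s t) = t)
    {I : Quaternion ℝ} (hI : I ∈ USphere) (hx : x I ≠ 0) {U : Set (Quaternion ℝ)} (hU : IsOpen U) (hIU : I ∈ U) :
    0 < (μH[2] : Measure (Quaternion ℝ)) (USphere ∩ U) := by
  set p : Quaternion ℝ → Fin 2 → ℝ := fun q => ![y q, z q] with hp
  have hpL : LipschitzWith 1 p := by
    refine LipschitzWith.of_dist_le_mul fun a b => ?_
    rw [NNReal.coe_one, one_mul, dist_eq_norm a b]
    refine (dist_pi_le_iff (norm_nonneg _)).2 fun i => ?_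
    fin_cases i
    · simpa [hp, Real.dist_eq] using hy a b
    · simpa [hp, Real.dist_eq] using hz a b
  set s : ℝ := x I / |x I| with hs
  have hax : |x I| ≠ 0 := abs_ne_zero.2 hx
  have hs2 : s ^ 2 = 1 := by rw [hs, div_pow, sq_abs, div_self (pow_ne_zero 2 hx)]
  set g : (Fin 2 → ℝ) → Quaternion ℝ := fun v => mk (s * Real.sqrt (1 - v 0 ^ 2 - v 1 ^ 2)) (v 0) (v 1) with hg
  have hgc : Continuous g := by
    have : Continuous fun v : Fin 2 → ℝ => ((s * Real.sqrt (1 - v 0 ^ 2 - v 1 ^ 2)), (v 0), (v 1)) := by fun_prop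
    exact hmk.comp this
  have hI2 := h2 I hI
  have hgI : g (p I) = I := by
    have e : 1 - y I ^ 2 - z I ^ 2 = x I ^ 2 := by linarith
    have : s * Real.sqrt (1 - y I ^ 2 - z I ^ 2) = x I := by
      rw [e, Real.sqrt_sq_eq_abs, hs, div_mul_cancel₀ _ hax]
    simp only [hg, hp, Matrix.cons_val_zero, Matrix.cons_val_one]
    rw [this, h1 I hI]
  set V : Set (Fin 2 → ℝ) := g ⁻¹' U ∩ {v | v 0 ^ 2 + v 1 ^ 2 < 1} with hV
  have hVo : IsOpen V := (hU.preimage hgc).inter (isOpen_lt (by fun_prop) (by fun_prop))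
  have hVI : p I ∈ V := by
    refine ⟨by show g (p I) ∈ U; rwa [hgI], ?_⟩
    show y I ^ 2 + z I ^ 2 < 1
    have : 0 < x I ^ 2 := by positivity
    linarith
  have hVpos : 0 < (volume : Measure (Fin 2 → ℝ)) V := hVo.measure_pos volume ⟨_, hVI⟩
  have hVs : V ⊆ p '' (USphere ∩ U) := by
    rintro v ⟨hv1, hv2⟩
    refine ⟨g v, ⟨?_, hv1⟩, ?_⟩
    · apply h3
      have hv2' : v 0 ^ 2 + v 1 ^ 2 < 1 := hv2
      rw [mul_pow, hs2, Real.sq_sqrt (by linarith)]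
      ring
    · ext i
      fin_cases i
      · simp [hp, hg, h4]
      · simp [hp, hg, h5]
  rw [← hm2] at hVpos
  have h := (hpL.lipschitzOnWith (s := USphere ∩ U)).hausdorffMeasure_image_le (d := 2) zero_le_two
  have := hVpos.trans_le ((measure_mono hVs).trans h)
  simpa using this

theorem q_co (q : Quaternion ℝ) : |q.imI| ≤ ‖q‖ ∧ |q.imJ| ≤ ‖q‖ ∧ |q.imK| ≤ ‖q‖ := by
  have := qnorm_sq q
  refine ⟨abs_le_of_sq_le_sq ?_ (norm_nonneg _), abs_le_of_sq_le_sq ?_ (norm_nonneg _), abs_le_of_sq_le_sq ?_ (norm_nonneg _)⟩ <;>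
  nlinarith [sq_nonneg q.re, sq_nonneg q.imI, sq_nonneg q.imJ, sq_nonneg q.imK]

theorem us_pos {I : Quaternion ℝ} (hI : I ∈ USphere) {U : Set (Quaternion ℝ)} (hU : IsOpen U) (hIU : I ∈ U) :
    0 < (μH[2] : Measure (Quaternion ℝ)) (USphere ∩ U) := by
  obtain ⟨h0, h1⟩ := us_re hI
  have hi : ∀ p q : Quaternion ℝ, |p.imI - q.imI| ≤ ‖p - q‖ := fun p q => by simpa using (q_co (p - q)).1
  have hj : ∀ p q : Quaternion ℝ, |p.imJ - q.imJ| ≤ ‖p - q‖ := fun p q => by simpa using (q_co (p - q)).2.1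
  have hk : ∀ p q : Quaternion ℝ, |p.imK - q.imK| ≤ ‖p - q‖ := fun p q => by simpa using (q_co (p - q)).2.2
  have hself : ∀ q ∈ USphere, mkQ 0 q.imI q.imJ q.imK = q := fun q hq => by
    ext <;> simp [mkQ_re, mkQ_i, mkQ_j, mkQ_k, (us_re hq).1]
  by_cases c1 : I.imI ≠ 0
  · exact us_pos_aux (fun q => q.imI) (fun q => q.imJ) (fun q => q.imK) (fun r s t => mkQ 0 r s t) hj hk
      (mkQ_cont (by fun_prop) (by fun_prop) (by fun_prop) (by fun_prop)) hself (fun q hq => (us_re hq).2)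
      (fun r s t h => us_of rfl h) (fun _ _ _ => rfl) (fun _ _ _ => rfl) hI c1 hU hIU
  by_cases c2 : I.imJ ≠ 0
  · exact us_pos_aux (fun q => q.imJ) (fun q => q.imI) (fun q => q.imK) (fun r s t => mkQ 0 s r t) hi hk
      (mkQ_cont (by fun_prop) (by fun_prop) (by fun_prop) (by fun_prop)) hself (fun q hq => by linarith [(us_re hq).2])
      (fun r s t h => us_of rfl (by show s ^ 2 + r ^ 2 + t ^ 2 = 1; linarith)) (fun _ _ _ => rfl) (fun _ _ _ => rfl) hI c2 hU hIU
  by_cases c3 : I.imK ≠ 0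
  · exact us_pos_aux (fun q => q.imK) (fun q => q.imI) (fun q => q.imJ) (fun r s t => mkQ 0 s t r) hi hj
      (mkQ_cont (by fun_prop) (by fun_prop) (by fun_prop) (by fun_prop)) hself (fun q hq => by linarith [(us_re hq).2])
      (fun r s t h => us_of rfl (by show s ^ 2 + t ^ 2 + r ^ 2 = 1; linarith)) (fun _ _ _ => rfl) (fun _ _ _ => rfl) hI c3 hU hIU
  push Not at c1 c2 c3
  rw [c1, c2, c3] at h1
  norm_num at h1

theorem ae_of_smul {α : Type*} [MeasurableSpace α] {μ : Measure α} {c : ℝ≥0∞} (hc : c ≠ 0) {P : α → Prop}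
    (h : ∀ᵐ x ∂(c • μ), P x) : ∀ᵐ x ∂μ, P x := by
  rw [ae_iff, Measure.smul_apply, smul_eq_mul, mul_eq_zero] at h
  exact ae_iff.2 (h.resolve_left hc)

theorem sph_finite : IsFiniteMeasure sphMeasure := by
  refine ⟨?_⟩
  have hqI : mkQ 0 1 0 0 ∈ USphere := us_of rfl (by simp [mkQ_i, mkQ_j, mkQ_k])
  have h1 := us_pos hqI isOpen_univ (Set.mem_univ _)
  rw [Set.inter_univ] at h1
  unfold sphMeasure
  rw [Measure.smul_apply, Measure.restrict_apply_univ, smul_eq_mul, ENNReal.inv_mul_cancel h1.ne' us_finite.ne]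
  exact ENNReal.one_lt_top

theorem sph_dense {P : Quaternion ℝ → Prop} (h : ∀ᵐ I ∂sphMeasure, P I) {I : Quaternion ℝ} (hI : I ∈ USphere)
    {U : Set (Quaternion ℝ)} (hU : IsOpen U) (hIU : I ∈ U) : ∃ J ∈ USphere ∩ U, P J := by
  by_contra hno
  push Not at hno
  unfold sphMeasure at h
  replace h := ae_of_smul (ENNReal.inv_ne_zero.2 us_finite.ne) h
  have h2 : (μH[2] : Measure (Quaternion ℝ)).restrict USphere U = 0 := by
    have hUS : MeasurableSet USphere := by
      have : IsClosed USphere := isClosed_eq (by fun_prop) continuous_const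
      exact this.measurableSet
    rw [ae_restrict_iff' hUS] at h
    rw [Measure.restrict_apply hU.measurableSet]
    refine measure_mono_null ?_ (ae_iff.1 h)
    intro J hJ hJ2
    exact hno J ⟨hJ.2, hJ.1⟩ (hJ2 hJ.2)
  rw [Measure.restrict_apply hU.measurableSet, Set.inter_comm] at h2
  exact (us_pos hI hU hIU).ne' h2

theorem sigma_slice {P : Quaternion ℝ → Prop} (h : ∀ᵐ q ∂SigmaBd, P q) :
    ∀ᵐ I ∂sphMeasure, ∀ᵐ t ∂mC, P (ptOn I t) := by
  have := sph_finite
  have : SecondCountableTopology (Quaternion ℝ) := by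
    have : ProperSpace (Quaternion ℝ) := FiniteDimensional.proper_real _
    infer_instance
  unfold SigmaBd at h
  replace h := ae_of_smul (ENNReal.inv_ne_zero.2 ENNReal.ofReal_ne_top) h
  have hm : Continuous (fun p : ℝ × Quaternion ℝ => ptOn p.2 p.1) := by
    unfold ptOn
    exact (Quaternion.continuous_coe.comp (Real.continuous_cos.comp continuous_fst)).add
      ((Real.continuous_sin.comp continuous_fst).smul continuous_snd)
  have h2 := ae_of_ae_map hm.measurable.aemeasurable h
  rw [← Measure.prod_swap] at h2
  have h3 := ae_of_ae_map measurable_swap.aemeasurable h2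
  exact Measure.ae_ae_of_ae_prod h3

theorem Iu_iota {I : Quaternion ℝ} (hI : I ∈ USphere) {z : ℂ} (hz : 0 < z.im) : Iu (iotaQ I z) = I := by
  obtain ⟨h0, h1⟩ := us_re hI
  have e : (iotaQ I z).im = z.im • I := by
    unfold iotaQ
    ext <;> simp [h0]
  have hn : ‖I‖ = 1 := by
    have := qnorm_sq I
    rw [h0] at this
    nlinarith [norm_nonneg I]
  have hne : z.im • I ≠ 0 := by
    intro h
    have := congrArg norm h
    rw [norm_smul, hn] at this
    simp at this
    exact hz.ne' this
  unfold Iu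
  rw [e, if_neg hne, norm_smul, hn, mul_one, Real.norm_of_nonneg hz.le, smul_smul, inv_mul_cancel₀ hz.ne', one_smul]

theorem mC_neBot : (ae mC).NeBot := by
  rw [ae_neBot]
  intro h
  have := congrArg (fun μ : Measure ℝ => μ Set.univ) h
  simp at this
  exact absurd this (not_le.2 Real.pi_pos)

theorem slice_zero {a : ℕ → Quaternion ℝ} (ha : MemH2 a) {I : Quaternion ℝ} (hI : I ∈ USphere) {z : ℂ} (hz : ‖z‖ < 1)
    (h : ∀ᶠ w in 𝓝 z, evalS a (iotaQ I w) = 0) : ∀ n, a n = 0 := by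
  have hb : ∀ᶠ w : ℂ in 𝓝 z, ‖w‖ < 1 := (continuous_norm.tendsto z).eventually (gt_mem_nhds hz)
  have key : ∀ u n, cofQ I u a n = 0 := by
    intro u
    refine cH_zero (cof_mem hI u ha) ?_
    have h1 : cEval (cofQ I u a) =ᶠ[𝓝 z] 0 := by
      filter_upwards [h, hb] with w hw hw1
      rw [cof_eval hI u ha hw1, hw, zero_mul, map_zero]
      rfl
    exact (cH_analytic (cof_mem hI u ha)).eqOn_zero_of_preconnected_of_eventuallyEq_zero
      (convex_ball (0 : ℂ) 1).isPreconnected (by simpa using hz) h1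
  intro n
  by_contra hn
  have := key (a n)⁻¹ n
  unfold cofQ at this
  rw [mul_inv_cancel₀ hn, piQ_apply] at this
  have := congrArg Complex.re this
  simp [q1_re] at this

theorem good_slice {a f : ℕ → Quaternion ℝ} (ha : MemH2 a) (hf : MemH2 f)
    (hmv : ∀ ω ∈ QBall,
      (2 * Real.pi)⁻¹ *
        (∫ θ in Set.Ico 0 (2 * Real.pi),
          Real.log ‖bdval a ((1 - ptOn (Iu ω) θ * star ω)⁻¹ * (ω - ptOn (Iu ω) θ))‖) =
      Real.log ‖evalS a ω‖)
    {I : Quaternion ℝ} (hI : I ∈ USphere) (hg : ∀ᵐ t ∂mC, ‖bdval a (ptOn I t)‖ = ‖bdval f (ptOn I t)‖)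
    {z : ℂ} (hz : ‖z‖ < 1) (hzi : 0 < z.im) : ‖evalS f (iotaQ I z)‖ ≤ ‖evalS a (iotaQ I z)‖ := by
  by_contra hlt
  push Not at hlt
  have hgt : ∀ w : ℂ, ‖w‖ < 1 → ∀ᵐ θ ∂mC, ‖bdval a (iotaQ I (tauC w (eC θ)))‖ = ‖bdval f (iotaQ I (tauC w (eC θ)))‖ := by
    intro w hw
    refine tau_ae (P := fun z => ‖bdval a (iotaQ I z)‖ = ‖bdval f (iotaQ I z)‖) hw ?_
    filter_upwards [hg] with t ht
    rwa [iota_eC]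
  have main : ∀ w : ℂ, ‖w‖ < 1 → 0 < w.im → ‖evalS a (iotaQ I w)‖ < ‖evalS f (iotaQ I w)‖ → evalS a (iotaQ I w) = 0 := by
    intro w hw hwi hl
    by_contra hne
    have hfne : evalS f (iotaQ I w) ≠ 0 := norm_pos_iff.1 ((norm_nonneg _).trans_lt hl)
    have h1 := (slice_jensen hf hI hw hfne).2
    have h2 := hmv (iotaQ I w) (by show ‖_‖ < 1; rwa [iota_norm hI])
    rw [Iu_iota hI hwi] at h2
    simp_rw [iota_tau hI] at h2
    have h3 : ∫ θ, Real.log ‖bdval f (iotaQ I (tauC w (eC θ)))‖ ∂mC = ∫ θ, Real.log ‖bdval a (iotaQ I (tauC w (eC θ)))‖ ∂mC := by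
      refine integral_congr_ae ?_
      filter_upwards [hgt w hw] with θ hθ
      simp only [hθ]
    rw [h3] at h1
    have hpi : (0 : ℝ) < 2 * Real.pi := by positivity
    have h4 : Real.log ‖evalS f (iotaQ I w)‖ ≤ Real.log ‖evalS a (iotaQ I w)‖ := by
      rw [← h2, inv_mul_eq_div, le_div_iff₀ hpi]
      linarith
    exact absurd (Real.log_lt_log (norm_pos_iff.2 hne) hl) (not_lt.2 h4)
  have hc : ∀ {b : ℕ → Quaternion ℝ}, MemH2 b → ContinuousAt (fun w : ℂ => ‖evalS b (iotaQ I w)‖) z := fun hb => by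
    have h1 : ContinuousAt (evalS _) (iotaQ I z) := (evalS_cont hb).continuousAt
      (Metric.isOpen_ball.mem_nhds (by rw [mem_ball_zero_iff, iota_norm hI]; exact hz))
    exact (h1.comp (f := iotaQ I) (iota_cont I).continuousAt).norm
  have hev : ∀ᶠ w in 𝓝 z, evalS a (iotaQ I w) = 0 := by
    filter_upwards [(hc ha).eventually_lt (hc hf) hlt, (continuous_norm.tendsto z).eventually (gt_mem_nhds hz),
      (Complex.continuous_im.tendsto z).eventually (lt_mem_nhds hzi)] with w h1 h2 h3
    exact main w h2 h3 h1
  have ha0 := slice_zero ha hI hz hev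
  have hbd : ∀ q, bdval a q = 0 := fun q => by
    refine bdval_eq ?_
    have : ∀ p, evalS a p = 0 := fun p => by simp [evalS, ha0]
    simp [this]
  have hfne : evalS f (iotaQ I z) ≠ 0 := norm_pos_iff.1 ((norm_nonneg _).trans_lt hlt)
  have h5 := (slice_jensen hf hI hz hfne).1
  have := mC_neBot
  obtain ⟨θ, h6, h7⟩ := (h5.and (hgt z hz)).exists
  rw [hbd, norm_zero] at h7
  exact h6 (norm_eq_zero.1 h7.symm)

theorem q_slice (q : Quaternion ℝ) : ∃ I ∈ USphere, ∃ z : ℂ, 0 ≤ z.im ∧ q = iotaQ I z := by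
  by_cases h : q.im = 0
  · refine ⟨mkQ 0 1 0 0, us_of rfl (by simp [mkQ_i, mkQ_j, mkQ_k]), (q.re : ℂ), by simp, ?_⟩
    rw [iota_ofReal]
    conv_lhs => rw [← Quaternion.re_add_im q, h, add_zero]
  · have hn : ‖q.im‖ ≠ 0 := norm_ne_zero_iff.2 h
    refine ⟨‖q.im‖⁻¹ • q.im, us_of (by simp) ?_, ⟨q.re, ‖q.im‖⟩, norm_nonneg _, ?_⟩
    · have := qnorm_sq q.im
      simp at this
      simp
      field_simp
      linarith
    · unfold iotaQ
      rw [smul_smul, mul_inv_cancel₀ hn, one_smul]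
      exact (Quaternion.re_add_im q).symm

theorem outer_main (a : ℕ → Quaternion ℝ) (ha : MemH2 a)
    (hmv : ∀ ω ∈ QBall,
      (2 * Real.pi)⁻¹ *
        (∫ θ in Set.Ico 0 (2 * Real.pi),
          Real.log ‖bdval a ((1 - ptOn (Iu ω) θ * star ω)⁻¹ * (ω - ptOn (Iu ω) θ))‖) =
      Real.log ‖evalS a ω‖) :
    IsOuterQ a := by
  refine ⟨ha, fun f hf hbd q hq => ?_⟩
  by_contra hlt
  push Not at hlt
  have hgood := sigma_slice hbd
  have hev : ∀ᶠ p in 𝓝 q, ‖evalS a p‖ < ‖evalS f p‖ ∧ ‖p‖ < 1 := by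
    have hq' : ‖q‖ < 1 := hq
    have hb : Metric.ball (0 : Quaternion ℝ) 1 ∈ 𝓝 q := Metric.isOpen_ball.mem_nhds (by simpa using hq')
    exact (((evalS_cont ha).continuousAt hb).norm.eventually_lt ((evalS_cont hf).continuousAt hb).norm hlt).and
      ((continuous_norm.tendsto q).eventually (gt_mem_nhds hq'))
  obtain ⟨O, hO1, hO2, hO3⟩ := eventually_nhds_iff.1 hev
  obtain ⟨I, hI, z, hz0, hqz⟩ := q_slice q
  -- push into the open upper half slice
  have hpush : Tendsto (fun ε : ℝ => iotaQ I (z + ε * Complex.I)) (𝓝[>] 0) (𝓝 q) := by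
    have : Continuous fun ε : ℝ => iotaQ I (z + ε * Complex.I) := (iota_cont I).comp (by fun_prop)
    have h2 := this.tendsto 0
    simp only [Complex.ofReal_zero, zero_mul, add_zero] at h2
    rw [hqz]
    exact h2.mono_left nhdsWithin_le_nhds
  obtain ⟨ε, h1, h2⟩ := ((hpush.eventually (hO2.mem_nhds hO3)).and self_mem_nhdsWithin).exists
  have hε : 0 < ε := h2
  set w : ℂ := z + ε * Complex.I with hw
  have hwi : 0 < w.im := by
    simp [hw]; linarith
  have hcJ : Continuous fun J : Quaternion ℝ => iotaQ J w := by
    unfold iotaQ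
    fun_prop
  obtain ⟨J, ⟨hJ, hJO⟩, hJg⟩ := sph_dense hgood hI (hO2.preimage hcJ) h1
  obtain ⟨k1, k2⟩ := hO1 _ hJO
  rw [iota_norm hJ] at k2
  exact absurd (good_slice ha hf hmv hJ hJg k2 hwi) (not_le.2 k1)

/-- If `f ∈ H²(𝔹)` satisfies the mean-value identity
`(1/2π) ∫₀^{2π} log |f_{I_ω}(τ_ω(e^{θ I_ω}))| dθ = log |f(ω)|` for every `ω ∈ 𝔹`
(with `τ_ω(z) = (1 - z ω̄)^{-1}(ω - z)` on the slice `L_{I_ω}`), then `f` is outer. -/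
theorem mean_value_log_implies_outer (a : ℕ → Quaternion ℝ) (ha : MemH2 a)
    (hmv : ∀ ω ∈ QBall,
      (2 * Real.pi)⁻¹ *
        (∫ θ in Set.Ico 0 (2 * Real.pi),
          Real.log ‖bdval a ((1 - ptOn (Iu ω) θ * star ω)⁻¹ * (ω - ptOn (Iu ω) θ))‖) =
      Real.log ‖evalS a ω‖) :
    IsOuterQ a := by
  exact outer_main a ha hmv
end

section
/- Let f ∈ H²(𝔹), let n ∈ ℕ, and let p_n be the optimal approximant of degree n of f^{−*}. Then f * p_n(q) = K_n(q, 0) for all q ∈ 𝔹, where K_n is the reproducing kernel of the finite-dimensional subspace f * 𝒫_n of H²(𝔹); in particular, if f(0) = 0 then p_n ≡ 0 for all n ∈ ℕ. -/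
open MeasureTheory Filter Topology
open scoped ENNReal Classical

lemma aux_star (x y : Quaternion ℝ) : ‖star x * y‖ ≤ ‖y‖ ^ 2 + ‖x‖ ^ 2 := by
  rw [norm_mul, norm_star]
  nlinarith [sq_nonneg (‖x‖ - ‖y‖), sq_nonneg ‖x‖, sq_nonneg ‖y‖]

lemma aux_inner_summable {x y : ℕ → Quaternion ℝ} (hx : MemH2 x) (hy : MemH2 y) :
    Summable (fun m => star (y m) * x m) :=
  Summable.of_norm_bounded (hx.add hy) (fun m => aux_star (y m) (x m))

lemma aux_memH2_add {x y : ℕ → Quaternion ℝ} (hx : MemH2 x) (hy : MemH2 y) :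
    MemH2 (fun m => x m + y m) := by
  refine Summable.of_nonneg_of_le (fun m => sq_nonneg _) (fun m => ?_)
    ((hx.add hy).mul_left 2)
  have h := norm_add_le (x m) (y m)
  have h0 := norm_nonneg (x m + y m)
  nlinarith [sq_nonneg (‖x m‖ - ‖y m‖)]

lemma aux_memH2_mul {x : ℕ → Quaternion ℝ} (hx : MemH2 x) (c : Quaternion ℝ) :
    MemH2 (fun m => x m * c) := by
  unfold MemH2
  simp only [norm_mul, mul_pow]
  exact hx.mul_right _

lemma aux_memH2_sum {ι : Type*} (s : Finset ι) (x : ι → ℕ → Quaternion ℝ)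
    (hx : ∀ i ∈ s, MemH2 (x i)) : MemH2 (fun m => ∑ i ∈ s, x i m) := by
  induction s using Finset.induction_on with
  | empty => simp [MemH2, summable_zero]
  | insert i s hi ih =>
    simp only [Finset.sum_insert hi]
    exact aux_memH2_add (hx i (by simp)) (ih fun j hj => hx j (by simp [hj]))

lemma aux_memH2_shift {a : ℕ → Quaternion ℝ} (ha : MemH2 a) (j : ℕ) :
    MemH2 (fun m => if j ≤ m then a (m - j) else 0) := by
  unfold MemH2
  rw [← summable_nat_add_iff j]
  simpa [MemH2] using ha

lemma aux_sProd_eq (a r : ℕ → Quaternion ℝ) (n : ℕ) (hr : IsPolyDeg r n) (m : ℕ) :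
    sProd a r m = ∑ j ∈ Finset.range (n + 1), (if j ≤ m then a (m - j) else 0) * r j := by
  unfold sProd
  rw [← Finset.sum_range_reflect]
  have h1 : ∀ k ∈ Finset.range (m + 1), a (m + 1 - 1 - k) * r (m - (m + 1 - 1 - k))
      = (if k ≤ m then a (m - k) else 0) * r k := by
    intro k hk
    have hk' : k ≤ m := by simp at hk; omega
    rw [if_pos hk']
    congr 2
    omega
  rw [Finset.sum_congr rfl h1]
  have h2 : ∀ N, n + 1 ≤ N → ∑ j ∈ Finset.range (n + 1), (if j ≤ m then a (m - j) else 0) * r j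
      = ∑ j ∈ Finset.range N, (if j ≤ m then a (m - j) else 0) * r j := by
    intro N hN
    refine Finset.sum_subset (by intro x; simp; omega) (fun x _ hx => ?_)
    rw [hr x (by simp at hx; omega), mul_zero]
  rw [h2 (n + 1 + (m + 1)) (by omega)]
  refine Finset.sum_subset (by intro x; simp; omega) (fun x _ hx => ?_)
  rw [if_neg (by simp at hx; omega), zero_mul]

lemma aux_memH2_sProd {a r : ℕ → Quaternion ℝ} (ha : MemH2 a) {n : ℕ} (hr : IsPolyDeg r n) :
    MemH2 (sProd a r) := by
  have : sProd a r = fun m => ∑ j ∈ Finset.range (n + 1),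
      (if j ≤ m then a (m - j) else 0) * r j := funext (aux_sProd_eq a r n hr)
  rw [this]
  exact aux_memH2_sum _ (fun j m => (if j ≤ m then a (m - j) else 0) * r j)
    fun j _ => aux_memH2_mul (aux_memH2_shift ha j) _

lemma aux_memH2_one : MemH2 oneS := by
  refine summable_of_ne_finset_zero (s := {0}) (fun m hm => ?_)
  simp at hm
  simp [oneS, constS, hm]

lemma aux_eval_summable {x : ℕ → Quaternion ℝ} (hx : MemH2 x) {q : Quaternion ℝ}
    (hq : q ∈ QBall) : Summable (fun m => q ^ m * x m) := by
  have hq' : ‖q‖ < 1 := hq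
  have h1 : Summable (fun m : ℕ => (‖q‖ ^ 2) ^ m) :=
    summable_geometric_of_lt_one (sq_nonneg _) (by nlinarith [norm_nonneg q])
  refine Summable.of_norm_bounded (hx.add h1) (fun m => ?_)
  rw [norm_mul, norm_pow, ← pow_mul, mul_comm 2 m, pow_mul]
  nlinarith [sq_nonneg (‖q‖ ^ m - ‖x m‖), sq_nonneg (‖q‖ ^ m), sq_nonneg ‖x m‖]

lemma aux_eval_zero (x : ℕ → Quaternion ℝ) : evalS x 0 = x 0 := by
  unfold evalS
  rw [tsum_eq_single 0]
  · simp
  · intro m hm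
    simp [hm]

lemma aux_dist {x : ℕ → Quaternion ℝ} (hx : MemH2 x) :
    h2distSq x oneS = ENNReal.ofReal (∑' m, ‖x m - oneS m‖ ^ 2) := by
  have h : MemH2 (fun m => x m - oneS m) := by
    have := aux_memH2_add hx (aux_memH2_mul aux_memH2_one (-1))
    simpa [sub_eq_add_neg] using this
  rw [ENNReal.ofReal_tsum_of_nonneg (fun m => sq_nonneg _) h]
  unfold h2distSq
  congr 1
  ext m
  rw [ENNReal.ofReal_pow (norm_nonneg _), ofReal_norm]
  rfl

/-- If `x ⊥ y` then Pythagoras. -/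
lemma aux_pyth {x y : ℕ → Quaternion ℝ} (hx : MemH2 x) (hy : MemH2 y)
    (h : h2inner y x = 0) :
    ∑' m, ‖x m + y m‖ ^ 2 = (∑' m, ‖x m‖ ^ 2) + ∑' m, ‖y m‖ ^ 2 := by
  have hs := aux_inner_summable hy hx
  have h1 : HasSum (fun m => star (x m) * y m) 0 := by
    have := hs.hasSum
    unfold h2inner at h
    rwa [h] at this
  have h2 : HasSum (fun m => (star (x m) * y m).re) 0 := by
    have := h1.map (⟨⟨fun q : Quaternion ℝ => q.re, rfl⟩, fun _ _ => rfl⟩ : Quaternion ℝ →+ ℝ)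
      Quaternion.continuous_re
    exact this
  have h3 := (hx.hasSum.add (h2.mul_left 2)).add hy.hasSum
  have h4 : (fun m => ‖x m + y m‖ ^ 2)
      = fun m => ‖x m‖ ^ 2 + 2 * (star (x m) * y m).re + ‖y m‖ ^ 2 := by
    ext m
    rw [norm_add_sq_real, Quaternion.inner_def]
    congr 3
    simp
  rw [h4, h3.tsum_eq]
  ring

lemma aux_inner_sum_right {ι : Type*} (s : Finset ι) (y : ℕ → Quaternion ℝ)
    (e : ι → ℕ → Quaternion ℝ) (d : ι → Quaternion ℝ) (hy : MemH2 y)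
    (he : ∀ i ∈ s, MemH2 (e i)) (h : ∀ i ∈ s, h2inner y (e i) = 0) :
    h2inner y (fun m => ∑ i ∈ s, e i m * d i) = 0 := by
  unfold h2inner
  have : ∀ m, star (∑ i ∈ s, e i m * d i) * y m = ∑ i ∈ s, star (d i) * (star (e i m) * y m) := by
    intro m
    rw [star_sum, Finset.sum_mul]
    simp only [star_mul, mul_assoc]
  simp only [this]
  rw [Summable.tsum_finsetSum (fun i hi => (aux_inner_summable hy (he i hi)).mul_left _)]
  refine Finset.sum_eq_zero fun i hi => ?_
  rw [(aux_inner_summable hy (he i hi)).tsum_mul_left]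
  have := h i hi
  unfold h2inner at this
  rw [this, mul_zero]

lemma aux_cancel (a p : ℕ → Quaternion ℝ) (ha : a ≠ 0) (h : sProd a p = 0) : p = 0 := by
  have hex : ∃ N, a N ≠ 0 := by
    by_contra! hc
    exact ha (funext hc)
  have hN := Nat.find_spec hex
  have hlt : ∀ k < Nat.find hex, a k = 0 := fun k hk => by
    simpa using Nat.find_min hex hk
  set N := Nat.find hex
  funext m
  induction m using Nat.strong_induction_on with
  | _ m ih =>
    have h1 := congrFun h (N + m)
    unfold sProd at h1
    rw [Finset.sum_eq_single N] at h1
    · simpa [hN] using h1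
    · intro k hk hkN
      rcases lt_or_gt_of_ne hkN with h2 | h2
      · rw [hlt k h2, zero_mul]
      · have hk' : k < N + m + 1 := by simpa using hk
        rw [ih (N + m - k) (by omega)]
        simp
    · intro hc
      simp at hc

theorem aux_main (a : ℕ → Quaternion ℝ) (ha : MemH2 a)
    (n : ℕ) (p : ℕ → Quaternion ℝ) (hp : IsOptApprox a n p)
    (φ : ℕ → ℕ → Quaternion ℝ) (hdeg : ∀ k, IsPolyDeg (φ k) k)
    (horth : ∀ j ∈ Finset.range (n + 1), ∀ k ∈ Finset.range (n + 1),
      h2inner (sProd a (φ j)) (sProd a (φ k)) = if j = k then 1 else 0)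
    (hspan : ∀ r, IsPolyDeg r n → ∃ c : ℕ → Quaternion ℝ,
      sProd a r = fun m => ∑ k ∈ Finset.range (n + 1), sProd a (φ k) m * c k) :
    sProd a p = fun m => ∑ k ∈ Finset.range (n + 1),
      sProd a (φ k) m * star (sProd a (φ k) 0) := by
  have he : ∀ k, MemH2 (sProd a (φ k)) := fun k => aux_memH2_sProd ha (hdeg k)
  set K : ℕ → Quaternion ℝ := fun m => ∑ k ∈ Finset.range (n + 1),
      sProd a (φ k) m * star (sProd a (φ k) 0) with hK
  have hKm : MemH2 K := aux_memH2_sum _ (fun k m => sProd a (φ k) m * star (sProd a (φ k) 0))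
    fun k _ => aux_memH2_mul (he k) _
  -- `K` lies in `f * 𝒫_n`
  set r : ℕ → Quaternion ℝ := fun m => ∑ k ∈ Finset.range (n + 1),
      φ k m * star (sProd a (φ k) 0) with hr
  have hrdeg : IsPolyDeg r n := by
    intro m hm
    refine Finset.sum_eq_zero fun k hk => ?_
    rw [hdeg k m (by simp at hk; omega), zero_mul]
  have hrK : sProd a r = K := by
    funext m
    simp only [hr, hK]
    conv_lhs => unfold sProd
    simp only [Finset.mul_sum]
    rw [Finset.sum_comm]
    refine Finset.sum_congr rfl fun k _ => ?_
    conv_rhs => enter [1]; unfold sProd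
    rw [Finset.sum_mul]
    simp only [mul_assoc]
    rfl
  have hopt := hp.2 r hrdeg
  have hpm := aux_memH2_sProd ha hp.1
  obtain ⟨c, hc⟩ := hspan p hp.1
  set y : ℕ → Quaternion ℝ := fun m => K m - oneS m with hy
  have hym : MemH2 y := by
    have := aux_memH2_add hKm (aux_memH2_mul aux_memH2_one (-1))
    simpa [hy, sub_eq_add_neg] using this
  set x : ℕ → Quaternion ℝ := fun m => ∑ k ∈ Finset.range (n + 1),
    sProd a (φ k) m * (c k - star (sProd a (φ k) 0)) with hx
  have hxm : MemH2 x := aux_memH2_sum _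
    (fun k m => sProd a (φ k) m * (c k - star (sProd a (φ k) 0)))
    fun k _ => aux_memH2_mul (he k) _
  have hxe : ∀ m, sProd a p m = x m + K m := by
    intro m
    rw [hc]
    simp only [hx, hK]
    rw [← Finset.sum_add_distrib]
    refine Finset.sum_congr rfl fun k _ => ?_
    rw [mul_sub, sub_add_cancel]
  -- orthogonality
  have hort : ∀ k ∈ Finset.range (n + 1), h2inner y (sProd a (φ k)) = 0 := by
    intro k hk
    unfold h2inner
    simp only [hy, mul_sub]
    rw [(aux_inner_summable hKm (he k)).tsum_sub (aux_inner_summable aux_memH2_one (he k))]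
    have h1 : ∑' m, star (sProd a (φ k) m) * oneS m = star (sProd a (φ k) 0) := by
      rw [tsum_eq_single 0]
      · simp [oneS, constS]
      · intro m hm
        simp [oneS, constS, hm]
    have h2 : ∑' m, star (sProd a (φ k) m) * K m = star (sProd a (φ k) 0) := by
      simp only [hK, Finset.mul_sum, ← mul_assoc]
      rw [Summable.tsum_finsetSum
        (fun i hi => (aux_inner_summable (he i) (he k)).mul_right _)]
      rw [Finset.sum_eq_single k]
      · rw [(aux_inner_summable (he k) (he k)).tsum_mul_right]
        have := horth k hk k hk
        unfold h2inner at this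
        rw [this]
        simp
      · intro j hj hjk
        rw [(aux_inner_summable (he j) (he k)).tsum_mul_right]
        have := horth j hj k hk
        unfold h2inner at this
        rw [this]
        simp [hjk]
      · intro hc
        exact absurd hk hc
    rw [h1, h2, sub_self]
  have hxy : h2inner y x = 0 := aux_inner_sum_right _ y _ _ hym (fun k _ => he k) hort
  have hpy := aux_pyth hxm hym hxy
  rw [hrK, aux_dist hpm, aux_dist hKm,
    ENNReal.ofReal_le_ofReal_iff (tsum_nonneg fun m => sq_nonneg _)] at hopt
  have h5 : ∑' m, ‖sProd a p m - oneS m‖ ^ 2 = ∑' m, ‖x m + y m‖ ^ 2 := by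
    congr 1
    ext m
    rw [hxe m, hy, add_sub_assoc]
  rw [h5, hpy] at hopt
  have h6 : ∑' m, ‖x m‖ ^ 2 ≤ 0 := by
    have : ∑' m, ‖K m - oneS m‖ ^ 2 = ∑' m, ‖y m‖ ^ 2 := rfl
    linarith
  funext m
  have h7 : ‖x m‖ ^ 2 ≤ 0 := le_trans (hxm.le_tsum m fun j _ => sq_nonneg _) h6
  have h8 : x m = 0 := by
    have : ‖x m‖ = 0 := by nlinarith [norm_nonneg (x m)]
    simpa using this
  rw [hxe m, h8, zero_add]

/-- Let `p` be the optimal approximant of degree `n` of `f^{-*}` and let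
`{f * φ_k}_{k=0}^n` be an orthonormal basis of `f * 𝒫_n` with `deg φ_k = k`. Then
`f * p (q) = K_n(q, 0) = ∑_{k=0}^n (f * φ_k)(q) conj((f * φ_k)(0))` on `𝔹`;
in particular, if `f(0) = 0` then `p ≡ 0`. -/
theorem opt_approx_eq_kernel (a : ℕ → Quaternion ℝ) (ha : MemH2 a)
    (n : ℕ) (p : ℕ → Quaternion ℝ) (hp : IsOptApprox a n p)
    (φ : ℕ → ℕ → Quaternion ℝ) (hdeg : ∀ k, IsPolyDeg (φ k) k)
    (horth : ∀ j ∈ Finset.range (n + 1), ∀ k ∈ Finset.range (n + 1),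
      h2inner (sProd a (φ j)) (sProd a (φ k)) = if j = k then 1 else 0)
    (hspan : ∀ r, IsPolyDeg r n → ∃ c : ℕ → Quaternion ℝ,
      sProd a r = fun m => ∑ k ∈ Finset.range (n + 1), sProd a (φ k) m * c k) :
    (∀ q ∈ QBall,
      evalS (sProd a p) q =
        ∑ k ∈ Finset.range (n + 1),
          evalS (sProd a (φ k)) q * star (evalS (sProd a (φ k)) 0)) ∧
    (evalS a 0 = 0 → p = 0) := by
  have hmain := aux_main a ha n p hp φ hdeg horth hspan
  have he : ∀ k, MemH2 (sProd a (φ k)) := fun k => aux_memH2_sProd ha (hdeg k)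
  refine ⟨fun q hq => ?_, fun h0 => ?_⟩
  · rw [hmain]
    simp only [aux_eval_zero]
    unfold evalS
    simp only [Finset.mul_sum, ← mul_assoc]
    rw [Summable.tsum_finsetSum (fun k _ => (aux_eval_summable (he k) hq).mul_right _)]
    refine Finset.sum_congr rfl fun k _ => ?_
    rw [(aux_eval_summable (he k) hq).tsum_mul_right]
  · rw [aux_eval_zero] at h0
    refine aux_cancel a p ?_ ?_
    · rintro rfl
      have := horth 0 (by simp) 0 (by simp)
      simp [h2inner, sProd] at this
    · rw [hmain]
      funext m
      have : ∀ k, sProd a (φ k) 0 = 0 := fun k => by simp [sProd, h0]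
      simp [this]
end
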